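/- Two-layer random network setup: fix an integer c ≥ 2. For positive integers d and n, let W¹ be an n×d random matrix with i.i.d. N(0,1/d) entries and W² a c×n random matrix with i.i.d. N(0,1/n) entries, independent of each other. Given (W¹,W²), for an input x ~ N(0, I_d) on ℝ^d define the n×n diagonal matrix D = D(x) with D_ii = 1 if (W¹x)_i ≥ 0 and D_ii = 0 otherwise; y = σ(W¹x) with σ the entrywise ReLU; z = W²y ∈ ℝ^c; p = softmax(z); A = A(x) = diag(p) − p pᵀ; and the output Hessian M = M(W¹,W²) = E_x[ D (W²)ᵀ A W² D ], an n×n symmetric positive semidefinite matrix. Then for every ε > 0, lim_{n→∞} lim_{d→∞} P_{(W¹,W²)}[ λ_c(M) / λ_{c−1}(M) < ε ] = 1, where λ_k(M) denotes the k-th largest eigenvalue of M. In other words, at random initialization with random Gaussian data, the output Hessian of the first layer is approximately of rank c − 1. -/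

import Mathlib

open MeasureTheory ProbabilityTheory Filter Matrix
open scoped NNReal ENNReal

/-- The standard Gaussian input distribution `N(0, I_d)` on `ℝ^d`. -/
noncomputable def inputMeasure (d : ℕ) : Measure (Fin d → ℝ) :=
  Measure.pi fun _ => gaussianReal 0 1

/-- The joint law of the two weight matrices: `W¹` is `n × d` with i.i.d. `N(0, 1/d)`
entries and, independently, `W²` is `c × n` with i.i.d. `N(0, 1/n)` entries. -/
noncomputable def weightMeasure (c d n : ℕ) :
    Measure (((Fin n × Fin d) → ℝ) × ((Fin c × Fin n) → ℝ)) :=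
  (Measure.pi fun _ : Fin n × Fin d => gaussianReal 0 (d : ℝ≥0)⁻¹).prod
    (Measure.pi fun _ : Fin c × Fin n => gaussianReal 0 (n : ℝ≥0)⁻¹)

/-- First-layer weights as an `n × d` matrix. -/
def W1of {n d : ℕ} (w : (Fin n × Fin d) → ℝ) : Matrix (Fin n) (Fin d) ℝ :=
  Matrix.of fun i j => w (i, j)

/-- Second-layer weights as a `c × n` matrix. -/
def W2of {c n : ℕ} (w : (Fin c × Fin n) → ℝ) : Matrix (Fin c) (Fin n) ℝ :=
  Matrix.of fun i j => w (i, j)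

/-- The softmax function on `ℝ^c`. -/
noncomputable def softmaxFn {c : ℕ} (z : Fin c → ℝ) : Fin c → ℝ :=
  fun i => Real.exp (z i) / ∑ k, Real.exp (z k)

/-- `A(z) = diag(softmax z) - softmax z (softmax z)ᵀ`. -/
noncomputable def Amat {c : ℕ} (z : Fin c → ℝ) : Matrix (Fin c) (Fin c) ℝ :=
  Matrix.diagonal (softmaxFn z) - Matrix.vecMulVec (softmaxFn z) (softmaxFn z)

/-- The diagonal ReLU-activation pattern matrix `D` of a pre-activation vector. -/
noncomputable def Dmat {n : ℕ} (u : Fin n → ℝ) : Matrix (Fin n) (Fin n) ℝ :=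
  Matrix.diagonal fun i => if 0 ≤ u i then (1 : ℝ) else 0

/-- The logits `z = W² σ(W¹ x)` of the two-layer ReLU network. -/
noncomputable def logits {c d n : ℕ}
    (w : ((Fin n × Fin d) → ℝ) × ((Fin c × Fin n) → ℝ)) (x : Fin d → ℝ) :
    Fin c → ℝ :=
  (W2of w.2).mulVec fun i => max ((W1of w.1).mulVec x i) 0

/-- The single-input output Hessian `D (W²)ᵀ A W² D` of the first layer. -/
noncomputable def hessOne {c d n : ℕ}
    (w : ((Fin n × Fin d) → ℝ) × ((Fin c × Fin n) → ℝ)) (x : Fin d → ℝ) :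
    Matrix (Fin n) (Fin n) ℝ :=
  Dmat ((W1of w.1).mulVec x) * (W2of w.2)ᵀ * Amat (logits w x) * W2of w.2 *
    Dmat ((W1of w.1).mulVec x)

/-- The output Hessian `M = E_x[D (W²)ᵀ A W² D]` (entrywise expectation over the
Gaussian input `x ~ N(0, I_d)`). -/
noncomputable def outputHessian (c d n : ℕ)
    (w : ((Fin n × Fin d) → ℝ) × ((Fin c × Fin n) → ℝ)) :
    Matrix (Fin n) (Fin n) ℝ :=
  Matrix.of fun i j => ∫ x, hessOne w x i j ∂(inputMeasure d)

/-- Squared Frobenius norm. -/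
noncomputable def frob2 {n m : ℕ} (A : Matrix (Fin n) (Fin m) ℝ) : ℝ :=
  ∑ i, ∑ j, (A i j) ^ 2

section Eigenvalues

variable {n : ℕ}

/-- `lam` lists the roots of the characteristic polynomial of `M` in nonincreasing order. -/
def IsSpectrum (M : Matrix (Fin n) (Fin n) ℝ) (lam : Fin n → ℝ) : Prop :=
  Antitone lam ∧ M.charpoly = ∏ k, (Polynomial.X - Polynomial.C (lam k))

theorem IsSpectrum.unique {M : Matrix (Fin n) (Fin n) ℝ} {lam mu : Fin n → ℝ}
    (h : IsSpectrum M lam) (h' : IsSpectrum M mu) : lam = mu := by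
  have key : ∀ l : Fin n → ℝ, IsSpectrum M l → M.charpoly.roots = (List.ofFn l : Multiset ℝ) := by
    intro l hl
    rw [hl.2, Polynomial.roots_prod _ _ (Finset.prod_ne_zero_iff.2 fun i _ =>
      Polynomial.X_sub_C_ne_zero _), ← Fin.univ_val_map]
    simp
  have hp : (List.ofFn lam).Perm (List.ofFn mu) :=
    Multiset.coe_eq_coe.1 ((key lam h).symm.trans (key mu h'))
  exact List.ofFn_injective (hp.eq_of_sortedGE h.1.sortedGE_ofFn h'.1.sortedGE_ofFn)

theorem exists_isSpectrum_eigenbasis {M : Matrix (Fin n) (Fin n) ℝ} (hM : M.IsHermitian) :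
    ∃ (lam : Fin n → ℝ) (b : Fin n → Fin n → ℝ), IsSpectrum M lam ∧
      (∀ i j, b i ⬝ᵥ b j = if i = j then 1 else 0) ∧ ∀ k, M *ᵥ b k = lam k • b k := by
  have hT := isSymmetric_toEuclideanLin_iff.mpr hM
  have hn : Module.finrank ℝ (EuclideanSpace ℝ (Fin n)) = n := finrank_euclideanSpace_fin
  refine ⟨hT.eigenvalues hn, fun k => (hT.eigenvectorBasis hn k).ofLp,
    ⟨hT.eigenvalues_antitone hn, ?_⟩, fun i j => ?_, fun k => ?_⟩
  · have := hT.charpoly_eq hn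
    have hc : (toEuclideanLin M).charpoly = M.charpoly := by
      rw [Matrix.toEuclideanLin_eq_toLin_orthonormal, charpoly_toLin]
    rw [hc] at this
    simpa using this
  · have := orthonormal_iff_ite.1 (hT.eigenvectorBasis hn).orthonormal j i
    rw [EuclideanSpace.inner_eq_star_dotProduct] at this
    simp only [star_trivial] at this
    rw [this]
    simp [eq_comm]
  · have := hT.apply_eigenvectorBasis hn k
    exact congrArg WithLp.ofLp this

theorem linearIndependent_of_dotProduct {b : Fin n → Fin n → ℝ}
    (hb : ∀ i j, b i ⬝ᵥ b j = if i = j then 1 else 0) : LinearIndependent ℝ b := by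
  rw [Fintype.linearIndependent_iff]
  intro g hg i
  have := congrArg (fun v => b i ⬝ᵥ v) hg
  simpa [dotProduct_sum, hb] using this

theorem exists_mem_ne_zero_of_finrank {b : Fin n → Fin n → ℝ}
    (hb : ∀ i j, b i ⬝ᵥ b j = if i = j then 1 else 0)
    (s : Finset (Fin n)) (U : Submodule ℝ (Fin n → ℝ))
    (hU : n < s.card + Module.finrank ℝ U) :
    ∃ c : Fin n → ℝ, ∑ i ∈ s, c i • b i ∈ U ∧ 0 < ∑ i ∈ s, c i ^ 2 := by
  have hli' : LinearIndependent ℝ (fun i : s => b i) := (linearIndependent_of_dotProduct hb).comp _ Subtype.val_injective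
  have hV := finrank_span_eq_card hli'
  set V := Submodule.span ℝ (Set.range fun i : s => b i) with hVdef
  have h1 := Submodule.finrank_sup_add_finrank_inf_eq V U
  have h2 : Module.finrank ℝ ↥(V ⊔ U) ≤ n := by
    simpa using Submodule.finrank_le (V ⊔ U)
  rw [hV, Fintype.card_coe] at h1
  have h3 : 0 < Module.finrank ℝ ↥(V ⊓ U) := by omega
  have : V ⊓ U ≠ ⊥ := by
    intro h
    rw [h, finrank_bot] at h3
    exact lt_irrefl _ h3
  obtain ⟨v, hv, hv0⟩ := Submodule.exists_mem_ne_zero_of_ne_bot this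
  obtain ⟨c, hc⟩ := (Submodule.mem_span_range_iff_exists_fun ℝ).1 hv.1
  classical
  have hsum : ∑ i ∈ s, (fun i => if h : i ∈ s then c ⟨i, h⟩ else 0) i • b i = v := by
    rw [← hc, ← Finset.sum_coe_sort s]
    refine Finset.sum_congr rfl fun i _ => by simp
  refine ⟨fun i => if h : i ∈ s then c ⟨i, h⟩ else 0, hsum ▸ hv.2, ?_⟩
  refine lt_of_le_of_ne (Finset.sum_nonneg fun i _ => sq_nonneg _) fun h0 => hv0 ?_
  rw [← hsum]
  refine Finset.sum_eq_zero fun i hi => ?_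
  have := (Finset.sum_eq_zero_iff_of_nonneg fun i _ => sq_nonneg _).1 h0.symm i hi
  rw [pow_eq_zero_iff two_ne_zero] at this
  simp only [this, zero_smul]

theorem dotProduct_orthonormal_sum {b : Fin n → Fin n → ℝ}
    (hb : ∀ i j, b i ⬝ᵥ b j = if i = j then 1 else 0) (s : Finset (Fin n)) (c d : Fin n → ℝ) :
    (∑ i ∈ s, c i • b i) ⬝ᵥ (∑ i ∈ s, d i • b i) = ∑ i ∈ s, c i * d i := by
  rw [sum_dotProduct]
  refine Finset.sum_congr rfl fun i hi => ?_
  rw [dotProduct_sum]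
  simp [hb, hi, mul_comm]

theorem mulVec_eigen_sum {M : Matrix (Fin n) (Fin n) ℝ} {lam : Fin n → ℝ}
    {b : Fin n → Fin n → ℝ} (hM : ∀ k, M *ᵥ b k = lam k • b k) (s : Finset (Fin n))
    (c : Fin n → ℝ) :
    M *ᵥ (∑ i ∈ s, c i • b i) = ∑ i ∈ s, (c i * lam i) • b i := by
  rw [Matrix.mulVec_sum]
  simp [Matrix.mulVec_smul, hM, smul_smul]

theorem IsSpectrum.le_of_finrank {M : Matrix (Fin n) (Fin n) ℝ} (hM : M.IsHermitian)
    {lam : Fin n → ℝ} (h : IsSpectrum M lam) (k : Fin n) (U : Submodule ℝ (Fin n → ℝ))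
    (hU : (k : ℕ) + 1 ≤ Module.finrank ℝ U) {a : ℝ}
    (ha : ∀ v ∈ U, a * (v ⬝ᵥ v) ≤ v ⬝ᵥ M *ᵥ v) : a ≤ lam k := by
  obtain ⟨mu, b, h', hb, hbM⟩ := exists_isSpectrum_eigenbasis hM
  obtain rfl := h.unique h'
  obtain ⟨c, hc, hc0⟩ := exists_mem_ne_zero_of_finrank hb (Finset.Ici k) U (by
    rw [Fin.card_Ici]; omega)
  have := ha _ hc
  rw [mulVec_eigen_sum hbM, dotProduct_orthonormal_sum hb, dotProduct_orthonormal_sum hb] at this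
  have h2 : ∑ i ∈ Finset.Ici k, c i * (c i * lam i) ≤ lam k * ∑ i ∈ Finset.Ici k, c i ^ 2 := by
    rw [Finset.mul_sum]
    refine Finset.sum_le_sum fun i hi => ?_
    have := h.1 (Finset.mem_Ici.1 hi)
    nlinarith [sq_nonneg (c i)]
  have h3 : ∑ i ∈ Finset.Ici k, c i * c i = ∑ i ∈ Finset.Ici k, c i ^ 2 := by simp [sq]
  rw [h3] at this
  exact le_of_mul_le_mul_right (this.trans h2) hc0

theorem IsSpectrum.ge_of_finrank {M : Matrix (Fin n) (Fin n) ℝ} (hM : M.IsHermitian)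
    {lam : Fin n → ℝ} (h : IsSpectrum M lam) (k : Fin n) (U : Submodule ℝ (Fin n → ℝ))
    (hU : n ≤ k + Module.finrank ℝ U) {a : ℝ}
    (ha : ∀ v ∈ U, v ⬝ᵥ M *ᵥ v ≤ a * (v ⬝ᵥ v)) : lam k ≤ a := by
  obtain ⟨mu, b, h', hb, hbM⟩ := exists_isSpectrum_eigenbasis hM
  obtain rfl := h.unique h'
  obtain ⟨c, hc, hc0⟩ := exists_mem_ne_zero_of_finrank hb (Finset.Iic k) U (by
    rw [Fin.card_Iic]; omega)
  have := ha _ hc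
  rw [mulVec_eigen_sum hbM, dotProduct_orthonormal_sum hb, dotProduct_orthonormal_sum hb] at this
  have h2 : lam k * ∑ i ∈ Finset.Iic k, c i ^ 2 ≤ ∑ i ∈ Finset.Iic k, c i * (c i * lam i) := by
    rw [Finset.mul_sum]
    refine Finset.sum_le_sum fun i hi => ?_
    have := h.1 (Finset.mem_Iic.1 hi)
    nlinarith [sq_nonneg (c i)]
  have h3 : ∑ i ∈ Finset.Iic k, c i * c i = ∑ i ∈ Finset.Iic k, c i ^ 2 := by simp [sq]
  rw [h3] at this
  exact le_of_mul_le_mul_right (h2.trans this) hc0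

/-- Monotonicity of ordered eigenvalues under comparison of quadratic forms. -/
theorem IsSpectrum.le_mul_add {M N : Matrix (Fin n) (Fin n) ℝ} (hM : M.IsHermitian)
    (hN : N.IsHermitian) {lam mu : Fin n → ℝ} (h : IsSpectrum M lam) (h' : IsSpectrum N mu)
    {a r : ℝ} (ha : 0 ≤ a)
    (hle : ∀ v : Fin n → ℝ, v ⬝ᵥ M *ᵥ v ≤ a * (v ⬝ᵥ N *ᵥ v) + r * (v ⬝ᵥ v)) (k : Fin n) :
    lam k ≤ a * mu k + r := by
  obtain ⟨mu', b, h'', hb, hbN⟩ := exists_isSpectrum_eigenbasis hN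
  obtain rfl := h'.unique h''
  obtain ⟨lam', b', hlam, hb', hbM⟩ := exists_isSpectrum_eigenbasis hM
  obtain rfl := h.unique hlam
  set U := Submodule.span ℝ (Set.range fun i : Finset.Ici k => b i) with hUdef
  refine h.ge_of_finrank hM k U ?_ fun v hv => ?_
  · have hli' : LinearIndependent ℝ (fun i : Finset.Ici k => b i) :=
      (linearIndependent_of_dotProduct hb).comp _ Subtype.val_injective
    have := finrank_span_eq_card hli'
    rw [hUdef, this, Fintype.card_coe, Fin.card_Ici]
    omega
  · obtain ⟨c, hc⟩ := (Submodule.mem_span_range_iff_exists_fun ℝ).1 hv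
    have hsum : ∑ i ∈ Finset.Ici k,
        (fun i => if h : i ∈ Finset.Ici k then c ⟨i, h⟩ else 0) i • b i = v := by
      rw [← hc, ← Finset.sum_coe_sort (Finset.Ici k)]
      refine Finset.sum_congr rfl fun i _ => by
        have := i.2
        simp only [dif_pos this]
    set c' : Fin n → ℝ := fun i => if h : i ∈ Finset.Ici k then c ⟨i, h⟩ else 0
    have h2 : v ⬝ᵥ N *ᵥ v ≤ mu k * (v ⬝ᵥ v) := by
      rw [← hsum, mulVec_eigen_sum hbN, dotProduct_orthonormal_sum hb,
        dotProduct_orthonormal_sum hb, Finset.mul_sum]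
      refine Finset.sum_le_sum fun i hi => ?_
      have := h'.1 (Finset.mem_Ici.1 hi)
      nlinarith [sq_nonneg (c' i)]
    calc _ ≤ _ := hle v
      _ ≤ a * (mu k * (v ⬝ᵥ v)) + r * (v ⬝ᵥ v) := by gcongr
      _ = _ := by ring

/-- The ordered eigenvalues of the symmetric part of a real square matrix. -/
noncomputable def sortedEig (M : Matrix (Fin n) (Fin n) ℝ) : Fin n → ℝ :=
  (exists_isSpectrum_eigenbasis (M := (2⁻¹ : ℝ) • (M + Mᵀ)) (by
    simp [Matrix.IsHermitian, Matrix.conjTranspose_eq_transpose_of_trivial, add_comm])).choose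

theorem isHermitian_symmPart (M : Matrix (Fin n) (Fin n) ℝ) :
    ((2⁻¹ : ℝ) • (M + Mᵀ)).IsHermitian := by
  simp [Matrix.IsHermitian, Matrix.conjTranspose_eq_transpose_of_trivial, add_comm]

theorem isSpectrum_symmPart (M : Matrix (Fin n) (Fin n) ℝ) :
    IsSpectrum ((2⁻¹ : ℝ) • (M + Mᵀ)) (sortedEig M) := by
  have := (exists_isSpectrum_eigenbasis (isHermitian_symmPart M)).choose_spec
  exact this.choose_spec.1

theorem symmPart_eq {M : Matrix (Fin n) (Fin n) ℝ} (hM : M.IsHermitian) :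
    (2⁻¹ : ℝ) • (M + Mᵀ) = M := by
  have : Mᵀ = M := by rw [← Matrix.conjTranspose_eq_transpose_of_trivial]; exact hM
  rw [this, ← two_smul ℝ M, smul_smul]
  norm_num

theorem isSpectrum_sortedEig {M : Matrix (Fin n) (Fin n) ℝ} (hM : M.IsHermitian) :
    IsSpectrum M (sortedEig M) := by
  simpa only [symmPart_eq hM] using isSpectrum_symmPart M

theorem dotProduct_symmPart (M : Matrix (Fin n) (Fin n) ℝ) (v : Fin n → ℝ) :
    v ⬝ᵥ ((2⁻¹ : ℝ) • (M + Mᵀ)) *ᵥ v = v ⬝ᵥ M *ᵥ v := by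
  have h : v ⬝ᵥ Mᵀ *ᵥ v = v ⬝ᵥ M *ᵥ v := by
    rw [Matrix.mulVec_transpose, dotProduct_comm, Matrix.dotProduct_mulVec]
  rw [Matrix.smul_mulVec, Matrix.add_mulVec, dotProduct_smul, dotProduct_add, h, smul_eq_mul]
  ring

theorem sortedEig_le_mul_add (M N : Matrix (Fin n) (Fin n) ℝ) {a r : ℝ} (ha : 0 ≤ a)
    (hle : ∀ v : Fin n → ℝ, v ⬝ᵥ M *ᵥ v ≤ a * (v ⬝ᵥ N *ᵥ v) + r * (v ⬝ᵥ v)) (k : Fin n) :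
    sortedEig M k ≤ a * sortedEig N k + r :=
  (isSpectrum_symmPart M).le_mul_add (isHermitian_symmPart M) (isHermitian_symmPart N)
    (isSpectrum_symmPart N) ha (fun v => by simpa only [dotProduct_symmPart] using hle v) k

theorem abs_dotProduct_mulVec_le (M : Matrix (Fin n) (Fin n) ℝ) (v : Fin n → ℝ) :
    |v ⬝ᵥ M *ᵥ v| ≤ √(∑ i, ∑ j, M i j ^ 2) * (v ⬝ᵥ v) := by
  have h1 : v ⬝ᵥ M *ᵥ v = ∑ p : Fin n × Fin n, M p.1 p.2 * (v p.1 * v p.2) := by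
    rw [Fintype.sum_prod_type]
    simp only [dotProduct, mulVec, Finset.mul_sum]
    exact Finset.sum_congr rfl fun i _ => Finset.sum_congr rfl fun j _ => by ring
  have h2 : v ⬝ᵥ v = √(∑ p : Fin n × Fin n, (v p.1 * v p.2) ^ 2) := by
    have : ∑ p : Fin n × Fin n, (v p.1 * v p.2) ^ 2 = (v ⬝ᵥ v) ^ 2 := by
      rw [Fintype.sum_prod_type, sq (v ⬝ᵥ v)]
      simp only [dotProduct, Finset.sum_mul_sum]
      exact Finset.sum_congr rfl fun i _ => Finset.sum_congr rfl fun j _ => by ring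
    rw [this, Real.sqrt_sq]
    exact Finset.sum_nonneg fun i _ => mul_self_nonneg _
  rw [h1, h2, ← Fintype.sum_prod_type' (f := fun i j => M i j ^ 2), ← Real.sqrt_mul (by positivity)]
  exact Real.abs_le_sqrt (Finset.sum_mul_sq_le_sq_mul_sq _ _ _)

theorem abs_sortedEig_sub_le (M N : Matrix (Fin n) (Fin n) ℝ) (k : Fin n) :
    |sortedEig M k - sortedEig N k| ≤ √(∑ i, ∑ j, (M i j - N i j) ^ 2) := by
  have key : ∀ A B : Matrix (Fin n) (Fin n) ℝ,
      sortedEig A k ≤ sortedEig B k + √(∑ i, ∑ j, (A i j - B i j) ^ 2) := by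
    intro A B
    have := sortedEig_le_mul_add A B (r := √(∑ i, ∑ j, (A i j - B i j) ^ 2)) zero_le_one
      (fun v => ?_) k
    · simpa using this
    · have h := (le_abs_self _).trans (abs_dotProduct_mulVec_le (A - B) v)
      rw [Matrix.sub_mulVec, dotProduct_sub] at h
      simp only [Matrix.sub_apply] at h
      linarith
  have h1 := key M N
  have h2 := key N M
  have : ∑ i, ∑ j, (N i j - M i j) ^ 2 = ∑ i, ∑ j, (M i j - N i j) ^ 2 :=
    Finset.sum_congr rfl fun i _ => Finset.sum_congr rfl fun j _ => by ring
  rw [this] at h2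
  rw [abs_le]
  constructor <;> linarith

theorem continuous_sortedEig (k : Fin n) :
    Continuous fun M : Matrix (Fin n) (Fin n) ℝ => sortedEig M k := by
  rw [continuous_iff_continuousAt]
  intro N
  rw [ContinuousAt, tendsto_iff_dist_tendsto_zero]
  have hc : Continuous fun M : Matrix (Fin n) (Fin n) ℝ => √(∑ i, ∑ j, (M i j - N i j) ^ 2) := by
    fun_prop
  have h0 := hc.tendsto N
  simp only [sub_self, ne_eq, OfNat.ofNat_ne_zero, not_false_eq_true, zero_pow,
    Finset.sum_const_zero, Real.sqrt_zero] at h0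
  exact squeeze_zero (fun _ => dist_nonneg)
    (fun M => by rw [Real.dist_eq]; exact abs_sortedEig_sub_le M N k) h0

theorem sortedEig_smul (M : Matrix (Fin n) (Fin n) ℝ) {a : ℝ} (ha : 0 < a) (k : Fin n) :
    sortedEig (a • M) k = a * sortedEig M k := by
  have hq : ∀ v : Fin n → ℝ, v ⬝ᵥ (a • M) *ᵥ v = a * (v ⬝ᵥ M *ᵥ v) := fun v => by
    rw [Matrix.smul_mulVec, dotProduct_smul, smul_eq_mul]
  apply le_antisymm
  · have := sortedEig_le_mul_add (a • M) M (r := 0) ha.le (fun v => by rw [hq]; simp) k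
    simpa using this
  · have := sortedEig_le_mul_add M (a • M) (r := 0) (inv_nonneg.2 ha.le)
      (fun v => by rw [hq]; field_simp; simp) k
    rw [add_zero] at this
    calc a * sortedEig M k ≤ a * (a⁻¹ * sortedEig (a • M) k) := by gcongr
      _ = _ := by field_simp

theorem sortedEig_diagonal {f : Fin n → ℝ} (hf : Antitone f) :
    sortedEig (Matrix.diagonal f) = f :=
  (isSpectrum_sortedEig (Matrix.isHermitian_diagonal f)).unique
    ⟨hf, Matrix.charpoly_diagonal f⟩

theorem sortedEig_nonneg {M : Matrix (Fin n) (Fin n) ℝ}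
    (hM : ∀ v : Fin n → ℝ, 0 ≤ v ⬝ᵥ M *ᵥ v) (k : Fin n) : 0 ≤ sortedEig M k := by
  have := sortedEig_le_mul_add (Matrix.diagonal fun _ : Fin n => (0 : ℝ)) M (r := 0) zero_le_one
    (fun v => by simpa using hM v) k
  rw [sortedEig_diagonal antitone_const] at this
  simpa using this

theorem antitone_sortedEig (M : Matrix (Fin n) (Fin n) ℝ) : Antitone (sortedEig M) :=
  (isSpectrum_symmPart M).1

end Eigenvalues

section RatioPolynomial

/-- A polynomial in the entries of a matrix which evaluates to `∏_{i ≠ j} (λ_i - ε λ_j)`. -/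
theorem exists_ratio_polynomial (n : ℕ) (ε : ℝ) :
    ∃ P : MvPolynomial (Fin n × Fin n) ℝ, ∀ (M : Matrix (Fin n) (Fin n) ℝ) (lam : Fin n → ℝ),
      M.charpoly = ∏ k, (Polynomial.X - Polynomial.C (lam k)) →
      MvPolynomial.aeval (fun p : Fin n × Fin n => M p.1 p.2) P
        = ∏ p : Fin n × Fin n, if p.1 = p.2 then 1 else lam p.1 - ε * lam p.2 := by
  set S : MvPolynomial (Fin n) ℝ := ∏ p : Fin n × Fin n,
    if p.1 = p.2 then 1 else MvPolynomial.X p.1 - MvPolynomial.C ε * MvPolynomial.X p.2 with hS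
  have hsymm : S ∈ MvPolynomial.symmetricSubalgebra (Fin n) ℝ := by
    rw [MvPolynomial.mem_symmetricSubalgebra]
    intro e
    rw [hS, map_prod]
    refine Fintype.prod_equiv (e.prodCongr e) _ _ fun p => ?_
    by_cases h : p.1 = p.2 <;> simp [h]
  obtain ⟨Q, hQ⟩ := MvPolynomial.esymmAlgHom_surjective (σ := Fin n) ℝ (n := n) (by simp)
    ⟨S, hsymm⟩
  have hQ' : MvPolynomial.aeval
      (fun i : Fin n => MvPolynomial.esymm (Fin n) ℝ (i + 1)) Q = S := by
    have h1 := congrArg (MvPolynomial.symmetricSubalgebra (Fin n) ℝ).val hQ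
    rw [MvPolynomial.esymmAlgHom, ← AlgHom.comp_apply, MvPolynomial.comp_aeval] at h1
    exact h1
  refine ⟨MvPolynomial.aeval (fun i : Fin n => (-1) ^ ((i : ℕ) + 1) *
    (charpoly.univ ℝ (Fin n)).coeff (n - (i + 1))) Q, fun M lam h => ?_⟩
  have hc : ∀ i : Fin n, MvPolynomial.aeval (fun p : Fin n × Fin n => M p.1 p.2)
      ((-1) ^ ((i : ℕ) + 1) * (charpoly.univ ℝ (Fin n)).coeff (n - (i + 1)))
      = MvPolynomial.aeval lam (MvPolynomial.esymm (Fin n) ℝ (i + 1)) := by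
    intro i
    have h1 : MvPolynomial.aeval (fun p : Fin n × Fin n => M p.1 p.2)
        ((charpoly.univ ℝ (Fin n)).coeff (n - (i + 1))) = M.charpoly.coeff (n - (i + 1)) := by
      have := charpoly.univ_coeff_eval₂Hom (Fin n) (RingHom.id ℝ)
        (fun p : Fin n × Fin n => M p.1 p.2) (n - (i + 1))
      exact this
    have h2 : M.charpoly.coeff (n - (i + 1)) = (-1) ^ ((i : ℕ) + 1) *
        (Finset.univ.val.map lam).esymm (i + 1) := by
      have h3 := Multiset.prod_X_sub_C_coeff (Finset.univ.val.map lam) (k := n - (i + 1))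
        (by simp)
      have h4 : Multiset.card (Finset.univ.val.map lam) - (n - ((i : ℕ) + 1)) = i + 1 := by
        have := i.2
        simp only [Multiset.card_map, Finset.card_val, Finset.card_univ, Fintype.card_fin]
        omega
      rw [h4] at h3
      rw [h, ← h3, Multiset.map_map]
      rfl
    rw [map_mul, h1, h2, MvPolynomial.aeval_esymm_eq_multiset_esymm, map_pow, map_neg, map_one,
      ← mul_assoc, ← mul_pow]
    norm_num
  rw [← AlgHom.comp_apply, MvPolynomial.comp_aeval]
  simp only [hc]
  have h5 : MvPolynomial.aeval lam S = MvPolynomial.aeval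
      (fun i : Fin n => MvPolynomial.aeval lam (MvPolynomial.esymm (Fin n) ℝ (i + 1))) Q := by
    rw [← hQ', ← AlgHom.comp_apply, MvPolynomial.comp_aeval]
  rw [← h5, hS, map_prod]
  refine Finset.prod_congr rfl fun p _ => ?_
  by_cases h : p.1 = p.2 <;> simp [h]

end RatioPolynomial

section NullSets

variable {ι : Type*} [Fintype ι]

theorem volume_eq_zero_of_ae_rays {Z : Set (ι → ℝ)} (hZ : MeasurableSet Z) (x₀ : ι → ℝ)
    (h : ∀ᵐ V : ι → ℝ, volume.restrict (Set.Ioi (0 : ℝ)) {t : ℝ | x₀ + t • V ∈ Z} = 0) :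
    volume Z = 0 := by
  have hm : MeasurableSet {q : (ι → ℝ) × ℝ | x₀ + q.2 • q.1 ∉ Z} := by
    have : Measurable fun q : (ι → ℝ) × ℝ => x₀ + q.2 • q.1 := by fun_prop
    exact this hZ.compl
  have h1 : ∀ᵐ V : ι → ℝ, ∀ᵐ t ∂(volume.restrict (Set.Ioi (0 : ℝ))), x₀ + t • V ∉ Z := by
    filter_upwards [h] with V hV
    rw [ae_iff]
    simpa using hV
  rw [Measure.ae_ae_comm hm] at h1
  have h2 : ∀ᵐ t ∂(volume.restrict (Set.Ioi (0 : ℝ))), (0 : ℝ) < t :=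
    ae_restrict_mem measurableSet_Ioi
  have : NeZero (volume.restrict (Set.Ioi (0 : ℝ))) := ⟨by simp⟩
  obtain ⟨t, ht, ht0⟩ := (h1.and h2).exists
  rw [ae_iff] at ht
  have h3 : {a : ι → ℝ | ¬ x₀ + t • a ∉ Z} = (fun a => t • a) ⁻¹' ((fun a => x₀ + a) ⁻¹' Z) := by
    ext a; simp
  rw [h3, Measure.addHaar_preimage_smul _ ht0.ne', measure_preimage_add] at ht
  have h4 : ENNReal.ofReal |(t ^ Module.finrank ℝ (ι → ℝ))⁻¹| ≠ 0 := by
    have : (0 : ℝ) < |(t ^ Module.finrank ℝ (ι → ℝ))⁻¹| := by positivity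
    simpa using this
  exact (mul_eq_zero.1 ht).resolve_left h4

theorem restrict_zero_set_eq_zero {f : ℝ → ℝ} {U : Set ℝ} (hf : AnalyticOnNhd ℝ f U)
    (hU : IsConnected U) (hm : MeasurableSet U) {x : ℝ} (hx : x ∈ U) (h : f x ≠ 0) :
    volume.restrict U {t | f t = 0} = 0 := by
  have h1 := hf.preimage_zero_mem_codiscreteWithin h hx hU
  have h2 := ae_restrict_le_codiscreteWithin (μ := volume) hm h1
  rw [mem_ae_iff] at h2
  convert! h2 using 2
  ext t
  simp

theorem volume_zero_set_eq_zero {f : (ι → ℝ) → ℝ} (hm : Measurable f) (x₀ : ι → ℝ)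
    (hx : f x₀ ≠ 0) (hf : ∀ V, AnalyticOnNhd ℝ (fun t : ℝ => f (x₀ + t • V)) Set.univ) :
    volume {x | f x = 0} = 0 := by
  refine volume_eq_zero_of_ae_rays (hm (measurableSet_singleton 0)) x₀ (.of_forall fun V => ?_)
  have h := restrict_zero_set_eq_zero (hf V) isConnected_univ MeasurableSet.univ
    (Set.mem_univ 0) (by simpa using hx)
  rw [Measure.restrict_univ] at h
  exact le_antisymm ((Measure.restrict_apply_le _ _).trans h.le) bot_le

end NullSets

section GaussianDensity

variable {ι : Type*} [Fintype ι]

theorem pi_gaussianReal_eq_withDensity {v : ℝ≥0} (hv : v ≠ 0) :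
    Measure.pi (fun _ : ι => gaussianReal 0 v)
      = volume.withDensity fun x => ENNReal.ofReal (∏ i, gaussianPDFReal 0 v (x i)) := by
  refine Measure.pi_eq fun s hs => ?_
  rw [withDensity_apply _ (MeasurableSet.univ_pi hs), volume_pi, Measure.restrict_pi_pi,
    ← ofReal_integral_eq_lintegral_ofReal]
  · rw [integral_fintype_prod_eq_prod (𝕜 := ℝ) (fun _ : ι => gaussianPDFReal 0 v),
      ENNReal.ofReal_prod_of_nonneg]
    · exact Finset.prod_congr rfl fun i _ => (gaussianReal_apply_eq_integral 0 hv _).symm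
    · exact fun i _ => integral_nonneg fun x => gaussianPDFReal_nonneg _ _ _
  · exact Integrable.fintype_prod fun i => (integrable_gaussianPDFReal 0 v).restrict
  · exact .of_forall fun x => Finset.prod_nonneg fun i _ => gaussianPDFReal_nonneg _ _ _

theorem pi_gaussianReal_absolutelyContinuous {v : ℝ≥0} (hv : v ≠ 0) :
    Measure.pi (fun _ : ι => gaussianReal 0 v) ≪ volume := by
  rw [pi_gaussianReal_eq_withDensity hv]
  exact withDensity_absolutelyContinuous _ _

theorem prod_gaussianPDFReal_std (x : ι → ℝ) :
    ∏ i, gaussianPDFReal 0 1 (x i)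
      = (√(2 * Real.pi))⁻¹ ^ Fintype.card ι * Real.exp (-((∑ i, x i ^ 2) / 2)) := by
  simp only [gaussianPDFReal, NNReal.coe_one, mul_one, sub_zero, Finset.prod_mul_distrib,
    Finset.prod_const, Finset.card_univ, ← Real.exp_sum]
  congr 2
  rw [Finset.sum_div, ← Finset.sum_neg_distrib]
  exact Finset.sum_congr rfl fun i _ => by ring

theorem integrable_exp_mul_sum_sq {s : ℝ} (hs : s < 0) :
    Integrable (fun x : ι → ℝ => Real.exp (s * ((∑ i, x i ^ 2) / 2))) := by
  have h : Integrable (fun x : ℝ => Real.exp (-(-s / 2) * x ^ 2)) :=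
    integrable_exp_neg_mul_sq (by linarith)
  have h2 := Integrable.fintype_prod (𝕜 := ℝ) (μ := fun _ : ι => (volume : Measure ℝ))
    (f := fun _ : ι => fun x : ℝ => Real.exp (-(-s / 2) * x ^ 2)) (fun _ => h)
  rw [← volume_pi] at h2
  refine h2.congr (.of_forall fun x => ?_)
  simp only [← Real.exp_sum]
  congr 1
  rw [Finset.sum_div, Finset.mul_sum]
  exact Finset.sum_congr rfl fun i _ => by ring

theorem analyticOnNhd_integral_exp_mul_sum_sq {φ : (ι → ℝ) → ℝ} (hφ : Measurable φ)
    (hb : ∀ x, |φ x| ≤ 1) :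
    AnalyticOnNhd ℝ (fun s : ℝ => ∫ x, Real.exp (s * ((∑ i, x i ^ 2) / 2)) * φ x) (Set.Iio 0) := by
  set q : (ι → ℝ) → ℝ := fun x => (∑ i, x i ^ 2) / 2 with hq
  set μ : Measure (ι → ℝ) := volume.withDensity fun x => ENNReal.ofReal (φ x + 1) with hμ
  have hnn : ∀ x, 0 ≤ φ x + 1 := fun x => by linarith [(abs_le.1 (hb x)).1]
  have h_int : ∀ s < 0, Integrable (fun x => Real.exp (s * q x) * φ x) := fun s hs => by
    refine (integrable_exp_mul_sum_sq hs).mul_bdd (c := 1) hφ.aestronglyMeasurable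
      (.of_forall fun x => by simpa using hb x)
  have h_int' : ∀ s < 0, Integrable (fun x => Real.exp (s * q x)) μ := fun s hs => by
    rw [hμ, integrable_withDensity_iff (by fun_prop) (.of_forall fun x => by simp)]
    refine ((h_int s hs).add (integrable_exp_mul_sum_sq hs)).congr (.of_forall fun x => ?_)
    simp only [Pi.add_apply, ENNReal.toReal_ofReal (hnn x)]
    ring
  have h1 : AnalyticOnNhd ℝ (mgf q μ) (Set.Iio 0) :=
    analyticOnNhd_mgf.mono (interior_maximal (fun s hs => h_int' s hs) isOpen_Iio)
  have h2 : AnalyticOnNhd ℝ (mgf q volume) (Set.Iio 0) :=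
    analyticOnNhd_mgf.mono
      (interior_maximal (fun s hs => integrable_exp_mul_sum_sq hs) isOpen_Iio)
  refine (h1.sub h2).congr isOpen_Iio fun s hs => ?_
  simp only [Pi.sub_apply, mgf]
  rw [hμ, integral_withDensity_eq_integral_toReal_smul (by fun_prop) (.of_forall fun x => by simp),
    ← integral_sub]
  · refine integral_congr_ae (.of_forall fun x => ?_)
    simp only [ENNReal.toReal_ofReal (hnn x), smul_eq_mul]
    ring
  · refine ((h_int s hs).add (integrable_exp_mul_sum_sq hs)).congr (.of_forall fun x => ?_)
    simp only [Pi.add_apply, ENNReal.toReal_ofReal (hnn x), smul_eq_mul]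
    ring
  · exact integrable_exp_mul_sum_sq hs

theorem analyticOnNhd_integral_gaussian_smul {φ : (ι → ℝ) → ℝ} (hφ : Measurable φ)
    (hb : ∀ x, |φ x| ≤ 1) :
    AnalyticOnNhd ℝ (fun t : ℝ => ∫ x, φ (t • x) ∂(Measure.pi fun _ : ι => gaussianReal 0 1))
      (Set.Ioi 0) := by
  have h1 : AnalyticOnNhd ℝ (fun t : ℝ => -((t ^ 2)⁻¹)) (Set.Ioi 0) := fun t ht =>
    ((analyticAt_id.pow 2).inv (pow_ne_zero 2 (ne_of_gt ht))).neg
  have h2 := (analyticOnNhd_integral_exp_mul_sum_sq hφ hb).comp h1 (fun t ht => by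
    have : (0 : ℝ) < t := ht
    simp only [Set.mem_Iio, Left.neg_neg_iff]
    positivity)
  have h3 : AnalyticOnNhd ℝ (fun t : ℝ => (t ^ Fintype.card ι)⁻¹) (Set.Ioi 0) := fun t ht =>
    (analyticAt_id.pow _).inv (pow_ne_zero _ (ne_of_gt ht))
  refine ((analyticOnNhd_const (v := (√(2 * Real.pi))⁻¹ ^ Fintype.card ι)).mul
    (h3.mul h2)).congr isOpen_Ioi fun t ht => ?_
  have ht : (0 : ℝ) < t := ht
  rw [pi_gaussianReal_eq_withDensity one_ne_zero,
    integral_withDensity_eq_integral_toReal_smul (by fun_prop) (.of_forall fun x => by simp)]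
  have h4 := Measure.integral_comp_smul (volume : Measure (ι → ℝ))
    (fun x => Real.exp (-((t ^ 2)⁻¹) * ((∑ i, x i ^ 2) / 2)) * φ x) t
  rw [abs_of_pos (by positivity), Module.finrank_fintype_fun_eq_card, smul_eq_mul] at h4
  simp only [Function.comp_apply]
  rw [← h4, ← integral_const_mul]
  refine integral_congr_ae (.of_forall fun x => ?_)
  simp only
  rw [ENNReal.toReal_ofReal (Finset.prod_nonneg fun i _ => gaussianPDFReal_nonneg _ _ _),
    prod_gaussianPDFReal_std, smul_eq_mul, ← mul_assoc]
  congr 3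
  simp only [Pi.smul_apply, smul_eq_mul, mul_pow, ← Finset.mul_sum]
  field_simp

end GaussianDensity

section Softmax

variable {c : ℕ}

theorem softmaxFn_nonneg (z : Fin c → ℝ) (k : Fin c) : 0 ≤ softmaxFn z k := by
  unfold softmaxFn; positivity

theorem sum_exp_pos (z : Fin c → ℝ) (k : Fin c) : 0 < ∑ k, Real.exp (z k) :=
  Finset.sum_pos (fun _ _ => Real.exp_pos _) ⟨k, Finset.mem_univ k⟩

theorem sum_softmaxFn (hc : c ≠ 0) (z : Fin c → ℝ) : ∑ k, softmaxFn z k = 1 := by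
  unfold softmaxFn
  rw [← Finset.sum_div, div_self (sum_exp_pos z ⟨0, Nat.pos_of_ne_zero hc⟩).ne']

theorem softmaxFn_le_one (z : Fin c → ℝ) (k : Fin c) : softmaxFn z k ≤ 1 := by
  rw [← sum_softmaxFn (fun h => by subst h; exact k.elim0) z]
  exact Finset.single_le_sum (fun i _ => softmaxFn_nonneg z i) (Finset.mem_univ k)

theorem softmaxFn_ratio (z z' : Fin c → ℝ) (k : Fin c) :
    softmaxFn z' k - softmaxFn z k ≤ 2 * ∑ m, |z' m - z m| := by
  set δ := ∑ m, |z' m - z m| with hδ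
  have hm : ∀ m, |z' m - z m| ≤ δ := fun m =>
    Finset.single_le_sum (f := fun m => |z' m - z m|) (fun i _ => abs_nonneg _)
      (Finset.mem_univ m)
  have h : Real.exp (-(2 * δ)) * softmaxFn z' k ≤ softmaxFn z k := by
    unfold softmaxFn
    rw [← mul_div_assoc, div_le_div_iff₀ (sum_exp_pos z' k) (sum_exp_pos z k)]
    have h1 : Real.exp (-δ) * Real.exp (z' k) ≤ Real.exp (z k) := by
      rw [← Real.exp_add]
      exact Real.exp_le_exp.2 (by linarith [(abs_le.1 (hm k)).2])
    have h2 : Real.exp (-δ) * ∑ m, Real.exp (z m) ≤ ∑ m, Real.exp (z' m) := by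
      rw [Finset.mul_sum]
      refine Finset.sum_le_sum fun m _ => ?_
      rw [← Real.exp_add]
      exact Real.exp_le_exp.2 (by linarith [(abs_le.1 (hm m)).1])
    have h3 := mul_le_mul h1 h2 (by positivity) (by positivity)
    calc _ = Real.exp (-δ) * Real.exp (z' k) * (Real.exp (-δ) * ∑ m, Real.exp (z m)) := by
          rw [show -(2 * δ) = -δ + -δ by ring, Real.exp_add]; ring
      _ ≤ _ := h3
  have h1 := Real.add_one_le_exp (-(2 * δ))
  nlinarith [softmaxFn_le_one z' k, softmaxFn_nonneg z' k,
    (Finset.sum_nonneg fun m _ => abs_nonneg _ : 0 ≤ δ)]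

theorem abs_softmaxFn_sub_le (z z' : Fin c → ℝ) (k : Fin c) :
    |softmaxFn z k - softmaxFn z' k| ≤ 2 * ∑ m, |z m - z' m| := by
  rw [abs_le]
  have h1 := softmaxFn_ratio z z' k
  have h2 := softmaxFn_ratio z' z k
  simp_rw [abs_sub_comm (z' _)] at h1
  constructor <;> linarith

theorem Amat_apply (z : Fin c → ℝ) (k l : Fin c) :
    Amat z k l = (if k = l then softmaxFn z k else 0) - softmaxFn z k * softmaxFn z l := by
  simp [Amat, Matrix.diagonal_apply, Matrix.vecMulVec_apply]

theorem abs_Amat_le_one (z : Fin c → ℝ) (k l : Fin c) : |Amat z k l| ≤ 1 := by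
  rw [Amat_apply, abs_le]
  have := softmaxFn_nonneg z k
  have := softmaxFn_nonneg z l
  have := softmaxFn_le_one z k
  have := softmaxFn_le_one z l
  split_ifs <;> constructor <;> nlinarith

theorem abs_Amat_sub_le (z z' : Fin c → ℝ) (k l : Fin c) :
    |Amat z k l - Amat z' k l| ≤ 6 * ∑ m, |z m - z' m| := by
  have hk := abs_le.1 (abs_softmaxFn_sub_le z z' k)
  have hl := abs_softmaxFn_sub_le z z' l
  set δ := ∑ m, |z m - z' m|
  have hδ : 0 ≤ δ := Finset.sum_nonneg fun m _ => abs_nonneg _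
  have h1 : |softmaxFn z k * (softmaxFn z l - softmaxFn z' l)| ≤ 1 * (2 * δ) := by
    rw [abs_mul, abs_of_nonneg (softmaxFn_nonneg z k)]
    exact mul_le_mul (softmaxFn_le_one z k) hl (abs_nonneg _) zero_le_one
  have h2 : |softmaxFn z' l * (softmaxFn z k - softmaxFn z' k)| ≤ 1 * (2 * δ) := by
    rw [abs_mul, abs_of_nonneg (softmaxFn_nonneg z' l)]
    exact mul_le_mul (softmaxFn_le_one z' l) (abs_softmaxFn_sub_le z z' k) (abs_nonneg _)
      zero_le_one
  rw [abs_le] at h1 h2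
  rw [Amat_apply, Amat_apply, abs_le]
  split_ifs <;> constructor <;> nlinarith

theorem Amat_comm (z : Fin c → ℝ) (k l : Fin c) : Amat z k l = Amat z l k := by
  rw [Amat_apply, Amat_apply, mul_comm]
  simp only [eq_comm (a := k)]
  split_ifs with h
  · rw [h]
  · rfl

theorem sum_Amat_mul (z a b : Fin c → ℝ) :
    ∑ k, ∑ l, a k * b l * Amat z k l
      = ∑ k, softmaxFn z k * (a k * b k)
        - (∑ k, softmaxFn z k * a k) * ∑ k, softmaxFn z k * b k := by
  simp only [Amat_apply, mul_sub, Finset.sum_sub_distrib, mul_ite, mul_zero,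
    Finset.sum_ite_eq, Finset.mem_univ, if_true]
  rw [Finset.sum_mul_sum]
  refine congrArg₂ (· - ·) (Finset.sum_congr rfl fun k _ => by ring)
    (Finset.sum_congr rfl fun k _ => Finset.sum_congr rfl fun l _ => by ring)

theorem sum_Amat_sq_eq (hc : c ≠ 0) (z a : Fin c → ℝ) :
    ∑ k, ∑ l, a k * a l * Amat z k l
      = ∑ k, softmaxFn z k * (a k - ∑ l, softmaxFn z l * a l) ^ 2 := by
  rw [sum_Amat_mul]
  set m := ∑ l, softmaxFn z l * a l
  have h : ∀ k, softmaxFn z k * (a k - m) ^ 2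
      = softmaxFn z k * (a k * a k) - 2 * m * (softmaxFn z k * a k) + m ^ 2 * softmaxFn z k :=
    fun k => by ring
  simp only [h, Finset.sum_add_distrib, Finset.sum_sub_distrib, ← Finset.mul_sum,
    sum_softmaxFn hc z]
  change _ - m * m = _ - 2 * m * m + _
  ring

theorem sum_Amat_sq_nonneg (z a : Fin c → ℝ) : 0 ≤ ∑ k, ∑ l, a k * a l * Amat z k l := by
  rcases eq_or_ne c 0 with rfl | hc
  · simp
  rw [sum_Amat_sq_eq hc]
  exact Finset.sum_nonneg fun k _ => mul_nonneg (softmaxFn_nonneg z k) (sq_nonneg _)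

theorem sum_Amat_eq_zero_of_const (hc : c ≠ 0) (z a : Fin c → ℝ) (t : ℝ) (h : ∀ k, a k = t) :
    ∑ k, ∑ l, a k * a l * Amat z k l = 0 := by
  rw [sum_Amat_sq_eq hc]
  simp only [h, ← Finset.sum_mul, sum_softmaxFn hc z]
  simp

theorem le_sum_Amat_sq (hc : c ≠ 0) (z a : Fin c → ℝ) (ha : ∑ k, a k = 0) {q : ℝ} (hq0 : 0 ≤ q)
    (hq : ∀ k, q ≤ softmaxFn z k) : q * ∑ k, a k ^ 2 ≤ ∑ k, ∑ l, a k * a l * Amat z k l := by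
  rw [sum_Amat_sq_eq hc]
  set m := ∑ l, softmaxFn z l * a l
  calc q * ∑ k, a k ^ 2 ≤ q * ∑ k, (a k - m) ^ 2 := by
        refine mul_le_mul_of_nonneg_left ?_ hq0
        have h : ∀ k, (a k - m) ^ 2 = a k ^ 2 - 2 * m * a k + m ^ 2 := fun k => by ring
        simp only [h, Finset.sum_add_distrib, Finset.sum_sub_distrib, ← Finset.mul_sum, ha]
        have : 0 ≤ ∑ _k : Fin c, m ^ 2 := Finset.sum_nonneg fun _ _ => sq_nonneg _
        linarith
    _ ≤ _ := by
        rw [Finset.mul_sum]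
        exact Finset.sum_le_sum fun k _ => mul_le_mul_of_nonneg_right (hq k) (sq_nonneg _)

theorem le_softmaxFn (z : Fin c → ℝ) {R : ℝ} (hR : ∀ k, |z k| ≤ R) (k : Fin c) :
    Real.exp (-(2 * R)) / c ≤ softmaxFn z k := by
  have hc : (0 : ℝ) < c := by exact_mod_cast k.pos
  unfold softmaxFn
  rw [div_le_div_iff₀ hc (sum_exp_pos z k)]
  have h1 : ∑ k, Real.exp (z k) ≤ c * Real.exp R := by
    calc _ ≤ ∑ _k : Fin c, Real.exp R :=
          Finset.sum_le_sum fun m _ => Real.exp_le_exp.2 (abs_le.1 (hR m)).2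
      _ = _ := by simp
  have h2 : Real.exp (-R) ≤ Real.exp (z k) := Real.exp_le_exp.2 (abs_le.1 (hR k)).1
  calc _ ≤ Real.exp (-(2 * R)) * (c * Real.exp R) := by gcongr
    _ = Real.exp (-R) * c := by
        rw [show -(2 * R) = -R + -R by ring, Real.exp_add, Real.exp_neg R]
        field_simp
    _ ≤ _ := by gcongr

theorem continuous_softmaxFn (k : Fin c) : Continuous fun z : Fin c → ℝ => softmaxFn z k := by
  unfold softmaxFn
  exact (by fun_prop : Continuous fun z : Fin c → ℝ => Real.exp (z k)).div (by fun_prop)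
    fun z => (sum_exp_pos z k).ne'

theorem continuous_Amat_apply (k l : Fin c) : Continuous fun z : Fin c → ℝ => Amat z k l := by
  simp only [Amat_apply]
  have hk := continuous_softmaxFn k
  have hl := continuous_softmaxFn l
  split_ifs <;> fun_prop

end Softmax

section Gate

variable {c n : ℕ}

/-- The ReLU gate of a pre-activation. -/
noncomputable def gate (t : ℝ) : ℝ := if 0 ≤ t then 1 else 0

theorem gate_nonneg (t : ℝ) : 0 ≤ gate t := by unfold gate; split_ifs <;> norm_num

theorem gate_le_one (t : ℝ) : gate t ≤ 1 := by unfold gate; split_ifs <;> norm_num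

theorem abs_gate_le_one (t : ℝ) : |gate t| ≤ 1 := by
  rw [abs_of_nonneg (gate_nonneg t)]; exact gate_le_one t

theorem gate_mul_self (t : ℝ) : gate t * gate t = gate t := by
  unfold gate; split_ifs <;> norm_num

theorem gate_mul_of_pos {s : ℝ} (hs : 0 < s) (t : ℝ) : gate (s * t) = gate t := by
  simp [gate, mul_nonneg_iff_of_pos_left hs]

@[fun_prop]
theorem measurable_gate : Measurable gate :=
  Measurable.ite measurableSet_Ici measurable_const measurable_const

theorem continuousAt_gate {t : ℝ} (ht : t ≠ 0) : ContinuousAt gate t := by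
  rcases lt_or_gt_of_ne ht with h | h
  · exact continuousAt_const.congr (f := fun _ => (0 : ℝ))
      ((gt_mem_nhds h).mono fun x hx => by simp [gate, not_le.2 hx])
  · exact continuousAt_const.congr (f := fun _ => (1 : ℝ))
      ((lt_mem_nhds h).mono fun x hx => by simp [gate, le_of_lt hx])

/-- The network output for the second-layer weights `w` and pre-activation vector `u`. -/
noncomputable def readout (w : Fin c × Fin n → ℝ) (u : Fin n → ℝ) : Fin c → ℝ :=
  W2of w *ᵥ fun i => max (u i) 0

/-- The output Hessian as a function of the second-layer weights and of the pre-activations. -/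
noncomputable def gateHess (w : Fin c × Fin n → ℝ) (u : Fin n → ℝ) : Matrix (Fin n) (Fin n) ℝ :=
  Dmat u * (W2of w)ᵀ * Amat (readout w u) * W2of w * Dmat u

theorem hessOne_eq {d : ℕ} (w : ((Fin n × Fin d) → ℝ) × ((Fin c × Fin n) → ℝ)) (x : Fin d → ℝ) :
    hessOne w x = gateHess w.2 (W1of w.1 *ᵥ x) := rfl

theorem gateHess_apply (w : Fin c × Fin n → ℝ) (u : Fin n → ℝ) (i j : Fin n) :
    gateHess w u i j
      = ∑ k, ∑ l, w (k, i) * w (l, j) * (gate (u i) * gate (u j) * Amat (readout w u) k l) := by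
  have hD : Dmat u = Matrix.diagonal fun i => gate (u i) := rfl
  rw [gateHess, hD, Matrix.mul_diagonal, Matrix.mul_apply, Finset.sum_comm, Finset.sum_mul]
  refine Finset.sum_congr rfl fun l _ => ?_
  rw [Matrix.mul_apply, Finset.sum_mul, Finset.sum_mul]
  refine Finset.sum_congr rfl fun k _ => ?_
  rw [Matrix.diagonal_mul]
  simp only [W2of, Matrix.transpose_apply, Matrix.of_apply]
  ring

theorem abs_gateHess_le (w : Fin c × Fin n → ℝ) (u : Fin n → ℝ) (i j : Fin n) :
    |gateHess w u i j| ≤ (∑ k, |w (k, i)|) * ∑ l, |w (l, j)| := by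
  rw [gateHess_apply, Finset.sum_mul_sum]
  refine (Finset.abs_sum_le_sum_abs _ _).trans (Finset.sum_le_sum fun k _ => ?_)
  refine (Finset.abs_sum_le_sum_abs _ _).trans (Finset.sum_le_sum fun l _ => ?_)
  rw [abs_mul, abs_mul, abs_mul, abs_mul]
  refine mul_le_of_le_one_right (by positivity) ?_
  exact mul_le_one₀ (mul_le_one₀ (abs_gate_le_one _) (abs_nonneg _) (abs_gate_le_one _))
    (abs_nonneg _) (abs_Amat_le_one _ _ _)

theorem gateHess_comm (w : Fin c × Fin n → ℝ) (u : Fin n → ℝ) (i j : Fin n) :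
    gateHess w u i j = gateHess w u j i := by
  rw [gateHess_apply, gateHess_apply, Finset.sum_comm]
  refine Finset.sum_congr rfl fun k _ => Finset.sum_congr rfl fun l _ => ?_
  rw [Amat_comm]; ring

theorem gateHess_form (w : Fin c × Fin n → ℝ) (u v : Fin n → ℝ) :
    v ⬝ᵥ gateHess w u *ᵥ v
      = ∑ k, ∑ l, (∑ i, w (k, i) * (gate (u i) * v i)) * (∑ i, w (l, i) * (gate (u i) * v i))
          * Amat (readout w u) k l := by
  have hD : Dmat u = Matrix.diagonal fun i => gate (u i) := rfl
  have hT : Dmat u * (W2of w)ᵀ = (W2of w * Dmat u)ᵀ := by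
    rw [Matrix.transpose_mul, hD, Matrix.diagonal_transpose]
  have hb : (W2of w * Dmat u) *ᵥ v = fun k => ∑ i, w (k, i) * (gate (u i) * v i) := by
    ext k
    simp [hD, Matrix.mulVec, dotProduct, Matrix.mul_diagonal, W2of, mul_assoc]
  rw [gateHess, hT, Matrix.mul_assoc, Matrix.mul_assoc, ← Matrix.mulVec_mulVec v _ᵀ,
    Matrix.dotProduct_mulVec, Matrix.vecMul_transpose, ← Matrix.mulVec_mulVec v (Amat _), hb]
  refine Finset.sum_congr rfl fun k _ => ?_
  rw [Matrix.mulVec, dotProduct, Finset.mul_sum]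
  exact Finset.sum_congr rfl fun l _ => by ring

theorem gateHess_nonneg (w : Fin c × Fin n → ℝ) (u v : Fin n → ℝ) :
    0 ≤ v ⬝ᵥ gateHess w u *ᵥ v := by
  rw [gateHess_form]; exact sum_Amat_sq_nonneg _ _

end Gate

section MeanHess

variable {c n : ℕ}

theorem measurable_readout_apply (k : Fin c) :
    Measurable fun p : (Fin c × Fin n → ℝ) × (Fin n → ℝ) => readout p.1 p.2 k := by
  simp only [readout, Matrix.mulVec, dotProduct, W2of, Matrix.of_apply]
  fun_prop

theorem measurable_Amat_readout (k l : Fin c) :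
    Measurable fun p : (Fin c × Fin n → ℝ) × (Fin n → ℝ) => Amat (readout p.1 p.2) k l :=
  (continuous_Amat_apply k l).measurable.comp
    (measurable_pi_iff.2 fun m => measurable_readout_apply m)

theorem measurable_gateHess (i j : Fin n) :
    Measurable fun p : (Fin c × Fin n → ℝ) × (Fin n → ℝ) => gateHess p.1 p.2 i j := by
  simp only [gateHess_apply]
  have h := fun k l => measurable_Amat_readout (c := c) (n := n) k l
  fun_prop

theorem measurable_gateHess_right (w : Fin c × Fin n → ℝ) (i j : Fin n) :
    Measurable fun u : Fin n → ℝ => gateHess w u i j := by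
  simp only [gateHess_apply]
  have h := fun k l => (measurable_Amat_readout (c := c) (n := n) k l).comp
    (measurable_prodMk_left (x := w))
  simp only [Function.comp_def] at h
  fun_prop

theorem integrable_gateHess (ν : Measure (Fin n → ℝ)) [IsFiniteMeasure ν]
    (w : Fin c × Fin n → ℝ) (i j : Fin n) : Integrable (fun u => gateHess w u i j) ν :=
  Integrable.of_bound (measurable_gateHess_right w i j).aestronglyMeasurable _
    (.of_forall fun u => abs_gateHess_le w u i j)

/-- The expected output Hessian when the pre-activations have law `ν`. -/
noncomputable def meanHess (ν : Measure (Fin n → ℝ)) (w : Fin c × Fin n → ℝ) :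
    Matrix (Fin n) (Fin n) ℝ :=
  Matrix.of fun i j => ∫ u, gateHess w u i j ∂ν

theorem outputHessian_eq_meanHess {d : ℕ} (w : ((Fin n × Fin d) → ℝ) × ((Fin c × Fin n) → ℝ)) :
    outputHessian c d n w
      = meanHess ((inputMeasure d).map fun x => W1of w.1 *ᵥ x) w.2 := by
  ext i j
  simp only [outputHessian, meanHess, Matrix.of_apply, hessOne_eq]
  rw [integral_map]
  · exact Measurable.aemeasurable (by
      refine measurable_pi_iff.2 fun i => ?_
      simp only [Matrix.mulVec, dotProduct]; fun_prop)
  · exact (measurable_gateHess_right w.2 i j).aestronglyMeasurable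

theorem measurable_meanHess (ν : Measure (Fin n → ℝ)) [IsFiniteMeasure ν] (i j : Fin n) :
    Measurable fun w : Fin c × Fin n → ℝ => meanHess ν w i j := by
  exact (measurable_gateHess i j).stronglyMeasurable.integral_prod_right'.measurable

theorem meanHess_form (ν : Measure (Fin n → ℝ)) [IsFiniteMeasure ν] (w : Fin c × Fin n → ℝ)
    (v : Fin n → ℝ) : v ⬝ᵥ meanHess ν w *ᵥ v = ∫ u, v ⬝ᵥ gateHess w u *ᵥ v ∂ν := by
  simp only [dotProduct, Matrix.mulVec, meanHess, Matrix.of_apply]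
  have h_int := integrable_gateHess ν w
  rw [integral_finsetSum _ fun i _ => Integrable.const_mul
    (integrable_finsetSum _ fun j _ => (h_int i j).mul_const _) _]
  refine Finset.sum_congr rfl fun i _ => ?_
  rw [integral_const_mul, integral_finsetSum _ fun j _ => (h_int i j).mul_const _]
  simp only [integral_mul_const]

theorem meanHess_nonneg (ν : Measure (Fin n → ℝ)) [IsFiniteMeasure ν] (w : Fin c × Fin n → ℝ)
    (v : Fin n → ℝ) : 0 ≤ v ⬝ᵥ meanHess ν w *ᵥ v := by
  rw [meanHess_form]
  exact integral_nonneg fun u => gateHess_nonneg w u v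

theorem isHermitian_meanHess (ν : Measure (Fin n → ℝ)) (w : Fin c × Fin n → ℝ) :
    (meanHess ν w).IsHermitian := by
  ext i j
  simp [meanHess, gateHess_comm w _ i j]

end MeanHess

section Flip

variable {n : ℕ}

instance (n : ℕ) : IsProbabilityMeasure (inputMeasure n) := by
  unfold inputMeasure; infer_instance

/-- Negating one coordinate. -/
def negCoord (i : Fin n) (u : Fin n → ℝ) : Fin n → ℝ := fun j => if j = i then -u j else u j

theorem measurePreserving_negCoord (i : Fin n) :
    MeasurePreserving (negCoord i) (inputMeasure n) (inputMeasure n) := by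
  have h := measurePreserving_pi (fun _ : Fin n => gaussianReal 0 1) (fun _ => gaussianReal 0 1)
    (f := fun j t => if j = i then -t else t) (fun j => by
      by_cases h : j = i
      · simp only [h, if_true]
        exact ⟨measurable_neg, by simpa using gaussianReal_map_neg (μ := 0) (v := 1)⟩
      · simp only [h, if_false]
        exact MeasurePreserving.id _)
  exact h

theorem ae_inputMeasure_ne_zero : ∀ᵐ u ∂inputMeasure n, ∀ i, u i ≠ 0 := by
  refine ae_all_iff.2 fun i => ?_
  have h : ∀ᵐ t ∂gaussianReal 0 1, t ≠ 0 := by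
    have := nullSingletonClass_gaussianReal (μ := 0) (v := 1) one_ne_zero
    exact compl_mem_ae_iff.2 (measure_singleton 0)
  exact (measurePreserving_eval (fun _ : Fin n => gaussianReal 0 1) i).quasiMeasurePreserving.ae h

theorem gate_neg {t : ℝ} (ht : t ≠ 0) : gate (-t) = 1 - gate t := by
  unfold gate
  rcases lt_or_gt_of_ne ht with h | h
  · rw [if_pos (by linarith), if_neg (by linarith)]; norm_num
  · rw [if_neg (by linarith), if_pos (by linarith)]; norm_num

theorem abs_integral_gate_sub_half_le (i : Fin n) {g : (Fin n → ℝ) → ℝ} (hg : Measurable g)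
    {C : ℝ} (hb : ∀ u, |g u| ≤ C) :
    |∫ u, (gate (u i) - 1 / 2) * g u ∂inputMeasure n|
      ≤ 1 / 4 * ∫ u, |g u - g (negCoord i u)| ∂inputMeasure n := by
  have hf := measurePreserving_negCoord i
  have hgm : Measurable fun u => g (negCoord i u) := hg.comp hf.measurable
  have hgi : Measurable fun u : Fin n → ℝ => gate (u i) := measurable_gate.comp (measurable_pi_apply i)
  have hgate : ∀ t, |gate t - 1 / 2| ≤ 1 / 2 := fun t => by
    unfold gate; split_ifs <;> norm_num [abs_le]
  have hi : Integrable (fun u => (gate (u i) - 1 / 2) * g u) (inputMeasure n) :=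
    Integrable.of_bound ((hgi.sub_const _).mul (by assumption)).aestronglyMeasurable (1 / 2 * C) (.of_forall fun u => by
      rw [Real.norm_eq_abs, abs_mul]
      exact mul_le_mul (hgate _) (hb u) (abs_nonneg _) (by norm_num))
  have hi' : Integrable (fun u => (gate (u i) - 1 / 2) * g (negCoord i u)) (inputMeasure n) :=
    Integrable.of_bound ((hgi.sub_const _).mul (by assumption)).aestronglyMeasurable (1 / 2 * C) (.of_forall fun u => by
      rw [Real.norm_eq_abs, abs_mul]
      exact mul_le_mul (hgate _) (hb _) (abs_nonneg _) (by norm_num))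
  have h1 : ∫ u, (gate (u i) - 1 / 2) * g u ∂inputMeasure n
      = -∫ u, (gate (u i) - 1 / 2) * g (negCoord i u) ∂inputMeasure n := by
    rw [← hf.map_eq, integral_map hf.measurable.aemeasurable
      (by rw [hf.map_eq]; exact hi.aestronglyMeasurable), ← integral_neg, hf.map_eq]
    refine integral_congr_ae (ae_inputMeasure_ne_zero.mono fun u hu => ?_)
    have : gate (negCoord i u i) = 1 - gate (u i) := by simp [negCoord, gate_neg (hu i)]
    simp only [this]; ring
  have h2 : ∫ u, (gate (u i) - 1 / 2) * g u ∂inputMeasure n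
      = 1 / 2 * ∫ u, (gate (u i) - 1 / 2) * (g u - g (negCoord i u)) ∂inputMeasure n := by
    have h4 : ∀ u, (gate (u i) - 1 / 2) * (g u - g (negCoord i u))
        = (gate (u i) - 1 / 2) * g u - (gate (u i) - 1 / 2) * g (negCoord i u) :=
      fun u => mul_sub _ _ _
    simp only [h4]
    rw [integral_sub hi hi']
    linarith
  rw [h2, abs_mul, abs_of_pos (by norm_num : (0 : ℝ) < 1 / 2)]
  have hd : Integrable (fun u => g u - g (negCoord i u)) (inputMeasure n) :=
    Integrable.of_bound (hg.sub hgm).aestronglyMeasurable (C + C) (.of_forall fun u =>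
      (abs_sub _ _).trans (add_le_add (hb _) (hb _)))
  have h3 : |∫ u, (gate (u i) - 1 / 2) * (g u - g (negCoord i u)) ∂inputMeasure n|
      ≤ ∫ u, 1 / 2 * |g u - g (negCoord i u)| ∂inputMeasure n := by
    refine abs_integral_le_integral_abs.trans (integral_mono_of_nonneg
      (.of_forall fun _ => abs_nonneg _) (hd.abs.const_mul _) (.of_forall fun u => ?_))
    simp only [abs_mul]
    exact mul_le_mul_of_nonneg_right (hgate _) (abs_nonneg _)
  rw [integral_const_mul] at h3
  linarith

theorem abs_integral_gate_gate_sub_le {i j : Fin n} (hij : i ≠ j) {g : (Fin n → ℝ) → ℝ}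
    (hg : Measurable g) {C : ℝ} (hb : ∀ u, |g u| ≤ C) :
    |∫ u, gate (u i) * gate (u j) * g u ∂inputMeasure n - 1 / 4 * ∫ u, g u ∂inputMeasure n|
      ≤ (∫ u, |g u - g (negCoord i u)| ∂inputMeasure n)
        + ∫ u, |g u - g (negCoord j u)| ∂inputMeasure n := by
  have hC : 0 ≤ C := (abs_nonneg _).trans (hb 0)
  have hb' : ∀ u : Fin n → ℝ, |gate (u j) * g u| ≤ C := fun u => by
    rw [abs_mul]
    exact (mul_le_of_le_one_left (abs_nonneg _) (abs_gate_le_one _)).trans (hb u)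
  have hgi : Measurable fun u : Fin n → ℝ => gate (u i) := measurable_gate.comp (measurable_pi_apply i)
  have hgj : Measurable fun u : Fin n → ℝ => gate (u j) := measurable_gate.comp (measurable_pi_apply j)
  have h1 := abs_integral_gate_sub_half_le i (g := fun u => gate (u j) * g u) (by fun_prop) hb'
  have h2 := abs_integral_gate_sub_half_le j hg hb
  have hi1 : Integrable (fun u => gate (u i) * (gate (u j) * g u)) (inputMeasure n) :=
    Integrable.of_bound (by fun_prop) C (.of_forall fun u => by
      rw [Real.norm_eq_abs, abs_mul]
      exact (mul_le_of_le_one_left (abs_nonneg _) (abs_gate_le_one _)).trans (hb' u))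
  have hi2 : Integrable (fun u => gate (u j) * g u) (inputMeasure n) :=
    Integrable.of_bound (by fun_prop) C (.of_forall hb')
  have hi3 : Integrable g (inputMeasure n) :=
    Integrable.of_bound (by fun_prop) C (.of_forall hb)
  have hd : ∀ i, Integrable (fun u => g u - g (negCoord i u)) (inputMeasure n) := fun i =>
    Integrable.of_bound (hg.sub (hg.comp (measurePreserving_negCoord i).measurable)).aestronglyMeasurable
      (C + C) (.of_forall fun u => (abs_sub _ _).trans (add_le_add (hb _) (hb _)))
  simp only [sub_mul] at h1 h2
  rw [integral_sub hi1 (hi2.const_mul _), integral_const_mul] at h1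
  rw [integral_sub hi2 (hi3.const_mul _), integral_const_mul] at h2
  have h3 : ∫ u, |gate (u j) * g u - gate (negCoord i u j) * g (negCoord i u)| ∂inputMeasure n
      ≤ ∫ u, |g u - g (negCoord i u)| ∂inputMeasure n := by
    refine integral_mono_of_nonneg (.of_forall fun _ => abs_nonneg _) (hd i).abs
      (.of_forall fun u => ?_)
    have : negCoord i u j = u j := by simp [negCoord, hij.symm]
    simp only [this, ← mul_sub, abs_mul]
    exact mul_le_of_le_one_left (abs_nonneg _) (abs_gate_le_one _)
  have h4 : 0 ≤ ∫ u, |g u - g (negCoord i u)| ∂inputMeasure n :=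
    integral_nonneg fun _ => abs_nonneg _
  have h5 : 0 ≤ ∫ u, |g u - g (negCoord j u)| ∂inputMeasure n :=
    integral_nonneg fun _ => abs_nonneg _
  simp only [mul_assoc]
  rw [abs_le] at h1 h2 ⊢
  constructor <;> linarith [h1.1, h1.2, h2.1, h2.2]

theorem integral_gate_mul_gate (i j : Fin n) :
    ∫ u, gate (u i) * gate (u j) ∂inputMeasure n = if i = j then 1 / 2 else 1 / 4 := by
  split_ifs with h
  · subst h
    simp only [gate_mul_self]
    have := abs_integral_gate_sub_half_le i (g := fun _ => 1) measurable_const (C := 1) (by simp)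
    have hi : Integrable (fun u => gate (u i)) (inputMeasure n) :=
      Integrable.of_bound (measurable_gate.comp (measurable_pi_apply i)).aestronglyMeasurable 1
        (.of_forall fun u => abs_gate_le_one _)
    simp only [mul_one, sub_self, abs_zero, integral_zero, mul_zero,
      integral_sub hi (integrable_const _), integral_const, probReal_univ, one_smul] at this
    exact sub_eq_zero.1 (abs_nonpos_iff.1 this)
  · have := abs_integral_gate_gate_sub_le h (g := fun _ => 1) measurable_const (C := 1) (by simp)
    simp only [mul_one, sub_self, abs_zero, integral_zero, add_zero, integral_const,
      probReal_univ, one_smul] at this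
    exact sub_eq_zero.1 (abs_nonpos_iff.1 this)

end Flip

section Blowup

variable {c n : ℕ}

/-- The expected Hessian at second-layer weights `t • w`, divided by `t ^ 2`. -/
noncomputable def scaledHess (t : ℝ) (w : Fin c × Fin n → ℝ) : Matrix (Fin n) (Fin n) ℝ :=
  Matrix.of fun i j => ∑ k, ∑ l, w (k, i) * w (l, j) *
    ∫ u, gate (u i) * gate (u j) * Amat (readout w (t • u)) k l ∂inputMeasure n

theorem readout_smul {t : ℝ} (ht : 0 ≤ t) (w : Fin c × Fin n → ℝ) (u : Fin n → ℝ) :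
    readout (t • w) u = readout w (t • u) := by
  ext k
  simp only [readout, Matrix.mulVec, dotProduct, W2of, Matrix.of_apply, Pi.smul_apply, smul_eq_mul]
  refine Finset.sum_congr rfl fun i _ => ?_
  rw [show max (t * u i) 0 = t * max (u i) 0 by rw [mul_max_of_nonneg _ _ ht, mul_zero]]
  ring

theorem continuous_readout (w : Fin c × Fin n → ℝ) : Continuous (readout w) := by
  unfold readout
  fun_prop

theorem measurable_gate_gate_Amat (w : Fin c × Fin n → ℝ) (t : ℝ) (i j : Fin n) (k l : Fin c) :
    Measurable fun u : Fin n → ℝ => gate (u i) * gate (u j) * Amat (readout w (t • u)) k l := by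
  have h : Measurable fun u : Fin n → ℝ => Amat (readout w (t • u)) k l :=
    ((continuous_Amat_apply k l).comp
      ((continuous_readout w).comp (continuous_const_smul t))).measurable
  have hi : Measurable fun u : Fin n → ℝ => gate (u i) :=
    measurable_gate.comp (measurable_pi_apply i)
  have hj : Measurable fun u : Fin n → ℝ => gate (u j) :=
    measurable_gate.comp (measurable_pi_apply j)
  exact (hi.mul hj).mul h

theorem abs_gate_gate_Amat_le (z : Fin c → ℝ) (s t : ℝ) (k l : Fin c) :
    |gate s * gate t * Amat z k l| ≤ 1 := by
  rw [abs_mul, abs_mul]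
  exact mul_le_one₀ (mul_le_one₀ (abs_gate_le_one _) (abs_nonneg _) (abs_gate_le_one _))
    (abs_nonneg _) (abs_Amat_le_one _ _ _)

theorem integrable_gate_gate_Amat (w : Fin c × Fin n → ℝ) (t : ℝ) (i j : Fin n) (k l : Fin c) :
    Integrable (fun u => gate (u i) * gate (u j) * Amat (readout w (t • u)) k l)
      (inputMeasure n) :=
  Integrable.of_bound (measurable_gate_gate_Amat w t i j k l).aestronglyMeasurable 1
    (.of_forall fun _ => abs_gate_gate_Amat_le _ _ _ k l)

theorem meanHess_smul {t : ℝ} (ht : 0 ≤ t) (w : Fin c × Fin n → ℝ) :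
    meanHess (inputMeasure n) (t • w) = t ^ 2 • scaledHess t w := by
  ext i j
  simp only [meanHess, scaledHess, Matrix.of_apply, Matrix.smul_apply, smul_eq_mul,
    gateHess_apply, readout_smul ht]
  have h_int := integrable_gate_gate_Amat w t i j
  rw [integral_finsetSum _ fun k _ => integrable_finsetSum _ fun l _ => (h_int k l).const_mul _,
    Finset.mul_sum]
  refine Finset.sum_congr rfl fun k _ => ?_
  rw [integral_finsetSum _ fun l _ => (h_int k l).const_mul _, Finset.mul_sum]
  refine Finset.sum_congr rfl fun l _ => ?_
  rw [integral_const_mul]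
  simp only [Pi.smul_apply, smul_eq_mul]
  ring

theorem continuous_scaledHess (w : Fin c × Fin n → ℝ) : Continuous fun t => scaledHess t w := by
  refine continuous_matrix fun i j => ?_
  simp only [scaledHess, Matrix.of_apply]
  refine continuous_finsetSum _ fun k _ => continuous_finsetSum _ fun l _ =>
    continuous_const.mul ?_
  refine continuous_of_dominated (bound := fun _ => 1)
    (fun t => (measurable_gate_gate_Amat w t i j k l).aestronglyMeasurable)
    (fun t => .of_forall fun _ => abs_gate_gate_Amat_le _ _ _ k l) (integrable_const _)
    (.of_forall fun u => continuous_const.mul ?_)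
  exact (continuous_Amat_apply k l).comp ((continuous_readout w).comp (by fun_prop))

theorem analyticOnNhd_scaledHess (w : Fin c × Fin n → ℝ) (i j : Fin n) :
    AnalyticOnNhd ℝ (fun t => scaledHess t w i j) (Set.Ioi 0) := by
  intro t ht
  simp only [scaledHess, Matrix.of_apply]
  refine Finset.analyticAt_fun_sum _ fun k _ => Finset.analyticAt_fun_sum _ fun l _ =>
    analyticAt_const.mul ?_
  have hm := measurable_gate_gate_Amat w 1 i j k l
  simp only [one_smul] at hm
  have h := analyticOnNhd_integral_gaussian_smul
    (φ := fun u => gate (u i) * gate (u j) * Amat (readout w u) k l) hm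
    (fun _ => abs_gate_gate_Amat_le _ _ _ k l) t ht
  refine h.congr ((lt_mem_nhds ht).mono fun s hs => ?_)
  simp only [Pi.smul_apply, smul_eq_mul, gate_mul_of_pos hs]
  rfl

theorem isHermitian_scaledHess (t : ℝ) (w : Fin c × Fin n → ℝ) :
    (scaledHess t w).IsHermitian := by
  ext i j
  simp only [scaledHess, Matrix.conjTranspose_apply, Matrix.of_apply, star_trivial]
  rw [Finset.sum_comm]
  refine Finset.sum_congr rfl fun k _ => Finset.sum_congr rfl fun l _ => ?_
  rw [mul_comm (w (l, j))]
  congr 2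
  ext u
  rw [Amat_comm, mul_comm (gate _)]

theorem scaledHess_zero (w : Fin c × Fin n → ℝ) (i j : Fin n) :
    scaledHess 0 w i j
      = ∑ k, ∑ l, w (k, i) * w (l, j) * ((if i = j then 1 / 2 else 1 / 4) * Amat 0 k l) := by
  have h0 : readout w 0 = 0 := by
    ext k; simp [readout, Matrix.mulVec, dotProduct]
  simp only [scaledHess, Matrix.of_apply, zero_smul, h0, integral_mul_const,
    integral_gate_mul_gate]

end Blowup

section LevelSet

variable {c n : ℕ}

theorem softmaxFn_zero (k : Fin c) : softmaxFn 0 k = (c : ℝ)⁻¹ := by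
  simp [softmaxFn]

theorem exists_scale (ε : ℝ) (hε : 0 < ε) (n : ℕ) :
    ∃ s : ℝ, 0 < s ∧ s ≤ 1 ∧ (n + 1) * s < ε ∧ ε * ((n + 1) * s) < 1 := by
  have hq : 0 < 1 + ε + 1 / ε := by positivity
  have hn : (0 : ℝ) < n + 1 := by positivity
  have h1 : ε * (1 / ε) = 1 := by field_simp
  have hi : 0 < 1 / ε := by positivity
  have e : (n + 1) * (1 / ((n + 1) * (1 + ε + 1 / ε))) = 1 / (1 + ε + 1 / ε) := by
    field_simp
  refine ⟨1 / ((n + 1) * (1 + ε + 1 / ε)), by positivity, ?_, ?_, ?_⟩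
  · rw [div_le_one (by positivity)]
    nlinarith [(Nat.cast_nonneg n : (0 : ℝ) ≤ n)]
  · rw [e, div_lt_iff₀ hq]; nlinarith
  · rw [e, mul_one_div, div_lt_one hq]; linarith

/-- At suitable weights the rescaled limit Hessian has well-separated eigenvalues. -/
theorem exists_scaledHess_separated (hc : 2 ≤ c) {ε : ℝ} (hε : 0 < ε) :
    ∃ w : Fin c × Fin n → ℝ, ∀ i j : Fin n, i ≠ j →
      sortedEig (scaledHess 0 w) i ≠ ε * sortedEig (scaledHess 0 w) j := by
  obtain ⟨s, hs0, hs1, hsε, hsε'⟩ := exists_scale ε hε n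
  set k₀ : Fin c := ⟨0, by omega⟩
  set r : Fin n → ℝ := fun i => √(s ^ (i : ℕ)) with hr
  have hrr : ∀ i, r i * r i = s ^ (i : ℕ) := fun i => Real.mul_self_sqrt (by positivity)
  set q : ℝ := Amat (0 : Fin c → ℝ) k₀ k₀ / 4 with hq
  have hq0 : 0 < q := by
    have hc' : (2 : ℝ) ≤ c := by exact_mod_cast hc
    have h1 : (c : ℝ)⁻¹ ≤ 1 / 2 := by
      rw [inv_eq_one_div]; exact one_div_le_one_div_of_le (by norm_num) hc'
    have h2 : 0 < (c : ℝ)⁻¹ := by positivity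
    rw [hq, Amat_apply, if_pos rfl, softmaxFn_zero]
    nlinarith
  set w : Fin c × Fin n → ℝ := fun p => if p.1 = k₀ then r p.2 else 0 with hw
  set M := scaledHess 0 w with hM
  have hMij : ∀ i j, M i j = q * ((if i = j then s ^ (i : ℕ) else 0) + r i * r j) := fun i j => by
    rw [hM, scaledHess_zero, Finset.sum_eq_single k₀ _ (by simp), Finset.sum_eq_single k₀ _ (by simp)]
    · simp only [hw, if_true]
      split_ifs with h
      · subst h; rw [hrr, hq]; ring
      · rw [hq]; ring
    · intro l _ hl; simp [hw, hl]
    · intro k _ hk; simp [hw, hk]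
  set N : Matrix (Fin n) (Fin n) ℝ := Matrix.diagonal fun i => s ^ (i : ℕ) with hN
  have hNf : ∀ v : Fin n → ℝ, v ⬝ᵥ N *ᵥ v = ∑ i, (r i * v i) ^ 2 := fun v => by
    simp only [hN, dotProduct, Matrix.mulVec_diagonal]
    refine Finset.sum_congr rfl fun i _ => ?_
    rw [← hrr]; ring
  have hMf : ∀ v : Fin n → ℝ, v ⬝ᵥ M *ᵥ v = q * (v ⬝ᵥ N *ᵥ v + (∑ i, r i * v i) ^ 2) := fun v => by
    rw [hNf, sq (∑ i, r i * v i), Finset.sum_mul_sum, ← Finset.sum_add_distrib, Finset.mul_sum]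
    refine Finset.sum_congr rfl fun i _ => ?_
    simp only [Matrix.mulVec, dotProduct, hMij, mul_add, add_mul, Finset.sum_add_distrib, mul_ite,
      ite_mul, mul_zero, zero_mul, Finset.sum_ite_eq, Finset.mem_univ, if_true, Finset.mul_sum]
    refine congrArg₂ (· + ·) (by rw [← hrr]; ring) (Finset.sum_congr rfl fun j _ => by ring)
  have hanti : Antitone fun i : Fin n => s ^ (i : ℕ) := fun i j hij =>
    pow_le_pow_of_le_one hs0.le hs1 hij
  have hNe : ∀ i, sortedEig N i = s ^ (i : ℕ) := fun i => by rw [hN, sortedEig_diagonal hanti]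
  have hlow : ∀ i : Fin n, q * s ^ (i : ℕ) ≤ sortedEig M i := fun i => by
    have h := sortedEig_le_mul_add N M (a := 1 / q) (r := 0) (by positivity) (fun v => by
      rw [hMf, ← mul_assoc, one_div_mul_cancel hq0.ne']
      nlinarith [sq_nonneg (∑ i, r i * v i)]) i
    rw [hNe, add_zero, one_div, ← div_eq_inv_mul, le_div_iff₀ hq0] at h
    linarith
  have hup : ∀ i : Fin n, sortedEig M i ≤ q * (n + 1) * s ^ (i : ℕ) := fun i => by
    have h := sortedEig_le_mul_add M N (a := q * (n + 1)) (r := 0) (by positivity) (fun v => by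
      have := sq_sum_le_card_mul_sum_sq (s := Finset.univ) (f := fun i => r i * v i)
      rw [← hNf, Finset.card_univ, Fintype.card_fin] at this
      rw [hMf]
      nlinarith) i
    rwa [hNe, add_zero] at h
  have hlt : ∀ i j : Fin n, i < j → sortedEig M j ≤ (n + 1) * s * sortedEig M i := fun i j hij => by
    have h1 : s ^ (j : ℕ) ≤ s ^ ((i : ℕ) + 1) := pow_le_pow_of_le_one hs0.le hs1 hij
    calc sortedEig M j ≤ q * (n + 1) * s ^ (j : ℕ) := hup j
      _ ≤ q * (n + 1) * s ^ ((i : ℕ) + 1) := by gcongr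
      _ = (n + 1) * s * (q * s ^ (i : ℕ)) := by ring
      _ ≤ _ := by gcongr; exact hlow i
  have hpos : ∀ i, 0 < sortedEig M i := fun i => lt_of_lt_of_le (by positivity) (hlow i)
  refine ⟨w, fun i j hij => ?_⟩
  rcases lt_or_gt_of_ne hij with h | h
  · have := hlt i j h
    have := hpos i
    refine ne_of_gt ?_
    calc ε * sortedEig M j ≤ ε * ((n + 1) * s * sortedEig M i) := by gcongr
      _ = ε * ((n + 1) * s) * sortedEig M i := by ring
      _ < 1 * sortedEig M i := by gcongr
      _ = _ := one_mul _
  · have := hpos j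
    refine ne_of_lt ?_
    calc sortedEig M i ≤ (n + 1) * s * sortedEig M j := hlt j i h
      _ < _ := by gcongr

theorem measurable_sortedEig_comp {α : Type*} [MeasurableSpace α]
    {F : α → Matrix (Fin n) (Fin n) ℝ} (hF : ∀ i j, Measurable fun w => F w i j) (k : Fin n) :
    Measurable fun w => sortedEig (F w) k := by
  have h2 : Measurable fun M : Fin n → Fin n → ℝ => sortedEig (Matrix.of M) k :=
    (show Continuous fun M : Fin n → Fin n → ℝ => sortedEig (Matrix.of M) k from
      (continuous_sortedEig k).comp continuous_id).measurable
  exact Measurable.comp (g := fun M : Fin n → Fin n → ℝ => sortedEig (Matrix.of M) k) h2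
    (measurable_pi_iff.2 fun i => measurable_pi_iff.2 fun j => hF i j)

theorem measurable_sortedEig_meanHess (ν : Measure (Fin n → ℝ)) [IsFiniteMeasure ν] (i : Fin n) :
    Measurable fun w : Fin c × Fin n → ℝ => sortedEig (meanHess ν w) i :=
  measurable_sortedEig_comp (measurable_meanHess ν) i

theorem analyticOnNhd_aeval_matrix {M : ℝ → Matrix (Fin n) (Fin n) ℝ} {s : Set ℝ}
    (h : ∀ i j, AnalyticOnNhd ℝ (fun t => M t i j) s) (P : MvPolynomial (Fin n × Fin n) ℝ) :
    AnalyticOnNhd ℝ (fun t => MvPolynomial.aeval (fun p : Fin n × Fin n => M t p.1 p.2) P) s := by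
  intro t ht
  refine AnalyticAt.aeval_mvPolynomial (fun p => ?_) P
  exact h p.1 p.2 t ht

theorem volume_sortedEig_ratio_eq_zero (hc : 2 ≤ c) {ε : ℝ} (hε : 0 < ε) {a b : Fin n}
    (hab : a ≠ b) :
    volume {w : Fin c × Fin n → ℝ | sortedEig (meanHess (inputMeasure n) w) a
      = ε * sortedEig (meanHess (inputMeasure n) w) b} = 0 := by
  obtain ⟨P, hP⟩ := exists_ratio_polynomial n ε
  set G : Matrix (Fin n) (Fin n) ℝ → ℝ := fun M => MvPolynomial.aeval (fun p => M p.1 p.2) P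
    with hG
  have hGe : ∀ M : Matrix (Fin n) (Fin n) ℝ, M.IsHermitian → G M
      = ∏ p : Fin n × Fin n, if p.1 = p.2 then 1 else sortedEig M p.1 - ε * sortedEig M p.2 :=
    fun M hM => hP M _ (isSpectrum_sortedEig hM).2
  have hGc : Continuous G := by
    exact (MvPolynomial.continuous_eval P).comp (by fun_prop)
  have hG0 : volume {w : Fin c × Fin n → ℝ | G (scaledHess 0 w) = 0} = 0 := by
    obtain ⟨w₀, hw₀⟩ := exists_scaledHess_separated (n := n) hc hε
    have hcont : Continuous fun w : Fin c × Fin n → ℝ => G (scaledHess 0 w) := by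
      refine hGc.comp (continuous_matrix fun i j => ?_)
      simp only [scaledHess_zero]
      fun_prop
    refine volume_zero_set_eq_zero hcont.measurable w₀ ?_ fun V t _ => ?_
    · rw [hGe _ (isHermitian_scaledHess 0 w₀)]
      refine Finset.prod_ne_zero_iff.2 fun p _ => ?_
      split_ifs with h
      · exact one_ne_zero
      · exact sub_ne_zero.2 (hw₀ _ _ h)
    · refine AnalyticAt.aeval_mvPolynomial (fun p => ?_) P
      simp only [scaledHess_zero, Pi.add_apply, Pi.smul_apply, smul_eq_mul]
      fun_prop
  have hmeas := measurable_sortedEig_meanHess (c := c) (inputMeasure n)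
  have hZ : MeasurableSet {w : Fin c × Fin n → ℝ | sortedEig (meanHess (inputMeasure n) w) a
      = ε * sortedEig (meanHess (inputMeasure n) w) b} :=
    measurableSet_eq_fun (hmeas a) ((hmeas b).const_mul ε)
  refine volume_eq_zero_of_ae_rays hZ 0 ?_
  have hae : ∀ᵐ w : Fin c × Fin n → ℝ, G (scaledHess 0 w) ≠ 0 :=
    measure_eq_zero_iff_ae_notMem.1 hG0
  filter_upwards [hae] with w hw
  have han : AnalyticOnNhd ℝ (fun t => G (scaledHess t w)) (Set.Ioi 0) :=
    analyticOnNhd_aeval_matrix (analyticOnNhd_scaledHess w) P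
  have hev : ∀ᶠ t in nhdsWithin (0 : ℝ) (Set.Ioi 0), G (scaledHess t w) ≠ 0 :=
    (((hGc.comp (continuous_scaledHess w)).tendsto 0).mono_left nhdsWithin_le_nhds).eventually_ne hw
  obtain ⟨t, ht, ht0⟩ := (hev.and self_mem_nhdsWithin).exists
  have hkey : ∀ τ : ℝ, 0 < τ → sortedEig (meanHess (inputMeasure n) (τ • w)) a
      = ε * sortedEig (meanHess (inputMeasure n) (τ • w)) b → G (scaledHess τ w) = 0 := by
    intro τ hτ h
    rw [meanHess_smul hτ.le, sortedEig_smul _ (by positivity), sortedEig_smul _ (by positivity)]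
      at h
    rw [hGe _ (isHermitian_scaledHess τ w)]
    refine Finset.prod_eq_zero (Finset.mem_univ (a, b)) ?_
    rw [if_neg hab, sub_eq_zero]
    have h2 : τ ^ 2 ≠ 0 := by positivity
    exact mul_left_cancel₀ h2 (by linarith)
  have hz := measure_eq_zero_iff_ae_notMem.1
    (restrict_zero_set_eq_zero han isConnected_Ioi measurableSet_Ioi ht0 ht)
  refine measure_eq_zero_iff_ae_notMem.2 ?_
  filter_upwards [hz, ae_restrict_mem measurableSet_Ioi] with τ hτ hpos hmem
  rw [zero_add] at hmem
  exact hτ (hkey τ hpos hmem)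

end LevelSet

section Moments

variable {ι : Type*} [Fintype ι]

theorem integral_comp_eval (v : ℝ≥0) (p : ι) {f : ℝ → ℝ} (hf : Measurable f) :
    ∫ w, f (w p) ∂(Measure.pi fun _ : ι => gaussianReal 0 v) = ∫ x, f x ∂gaussianReal 0 v := by
  have h := measurePreserving_eval (fun _ : ι => gaussianReal 0 v) p
  have h2 := integral_map (f := f)
    (μ := Measure.pi fun _ : ι => gaussianReal 0 v) h.measurable.aemeasurable hf.aestronglyMeasurable
  rw [h.map_eq] at h2
  exact h2.symm

theorem integrable_comp_eval (v : ℝ≥0) (p : ι) {f : ℝ → ℝ} (hf : Integrable f (gaussianReal 0 v)) :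
    Integrable (fun w => f (w p)) (Measure.pi fun _ : ι => gaussianReal 0 v) :=
  (measurePreserving_eval (fun _ : ι => gaussianReal 0 v) p).integrable_comp_of_integrable hf

theorem integrable_abs_pow_gaussianReal (v : ℝ≥0) (q : ℕ) :
    Integrable (fun x : ℝ => |x| ^ q) (gaussianReal 0 v) := by
  have h : MemLp id ((q : ℝ≥0) : ℝ≥0∞) (gaussianReal 0 v) := memLp_id_gaussianReal (q : ℝ≥0)
  rw [ENNReal.coe_natCast] at h
  exact h.integrable_norm_pow'

theorem integrable_sq_gaussianReal (v : ℝ≥0) : Integrable (fun x : ℝ => x ^ 2) (gaussianReal 0 v) := by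
  simpa only [sq_abs] using integrable_abs_pow_gaussianReal v 2

theorem integrable_pow_four_gaussianReal (v : ℝ≥0) :
    Integrable (fun x : ℝ => x ^ 4) (gaussianReal 0 v) := by
  have h := integrable_abs_pow_gaussianReal v 4
  simpa only [Even.pow_abs (show Even 4 by decide)] using h

theorem integral_sq_gaussianReal (v : ℝ≥0) : ∫ x, x ^ 2 ∂gaussianReal 0 v = v := by
  have h := variance_eq_sub (X := id) (μ := gaussianReal 0 v) (by
    simpa using memLp_id_gaussianReal (μ := 0) (v := v) 2)
  rw [variance_id_gaussianReal] at h
  simp only [Pi.pow_apply, id_eq, integral_id_gaussianReal] at h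
  linarith

theorem integral_pow_four_gaussianReal (v : ℝ≥0) :
    ∫ x, x ^ 4 ∂gaussianReal 0 v = v ^ 2 * ∫ x, x ^ 4 ∂gaussianReal 0 1 := by
  have h := gaussianReal_map_const_mul (μ := 0) (v := 1) (√(v : ℝ))
  have hv : NNReal.mk (√(v : ℝ) ^ 2) (sq_nonneg _) * 1 = v := by
    ext; simp
  rw [mul_zero, hv] at h
  rw [← h, integral_map (by fun_prop) (by fun_prop), ← integral_const_mul]
  refine integral_congr_ae (.of_forall fun x => ?_)
  have : √(v : ℝ) ^ 4 = (v : ℝ) ^ 2 := by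
    rw [show (4 : ℕ) = 2 * 2 by rfl, pow_mul, Real.sq_sqrt v.coe_nonneg]
  simp only [mul_pow, this]

theorem iIndepFun_eval (v : ℝ≥0) :
    iIndepFun (fun (p : ι) (w : ι → ℝ) => w p) (Measure.pi fun _ : ι => gaussianReal 0 v) :=
  iIndepFun_pi (X := fun _ x => x) (fun _ => aemeasurable_id)

theorem integral_mul_eval [DecidableEq ι] (v : ℝ≥0) (p q : ι) :
    ∫ w, w p * w q ∂(Measure.pi fun _ : ι => gaussianReal 0 v)
      = if p = q then (v : ℝ) else 0 := by
  split_ifs with h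
  · subst h
    simp only [← sq]
    rw [integral_comp_eval v p (f := fun x => x ^ 2) (by fun_prop), integral_sq_gaussianReal]
  · rw [((iIndepFun_eval v).indepFun h).integral_fun_mul_eq_mul_integral
      (measurable_pi_apply p).aestronglyMeasurable (measurable_pi_apply q).aestronglyMeasurable,
      integral_comp_eval v p (f := fun x => x) (by fun_prop),
      integral_id_gaussianReal, zero_mul]

theorem memLp_mul_eval (v : ℝ≥0) (p q : ι) :
    MemLp (fun w => w p * w q) 2 (Measure.pi fun _ : ι => gaussianReal 0 v) := by
  rw [memLp_two_iff_integrable_sq (by fun_prop)]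
  have hp := integrable_comp_eval v p (integrable_pow_four_gaussianReal v)
  have hq := integrable_comp_eval v q (integrable_pow_four_gaussianReal v)
  refine (hp.add hq).mono' (by fun_prop) (.of_forall fun w => ?_)
  rw [Real.norm_of_nonneg (sq_nonneg _), Pi.add_apply, mul_pow]
  nlinarith [sq_nonneg (w p ^ 2 - w q ^ 2), sq_nonneg (w p ^ 2), sq_nonneg (w q ^ 2)]

theorem integral_mul_eval_sq_le (v : ℝ≥0) (p q : ι) :
    ∫ w, (w p * w q) ^ 2 ∂(Measure.pi fun _ : ι => gaussianReal 0 v)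
      ≤ v ^ 2 * ∫ x, x ^ 4 ∂gaussianReal 0 1 := by
  have hp := integrable_comp_eval v p (integrable_pow_four_gaussianReal v)
  have hq := integrable_comp_eval v q (integrable_pow_four_gaussianReal v)
  calc _ ≤ ∫ w, (1 / 2) * (w p ^ 4 + w q ^ 4) ∂(Measure.pi fun _ : ι => gaussianReal 0 v) := by
        refine integral_mono (memLp_mul_eval v p q).integrable_sq ((hp.add hq).const_mul _)
          fun w => ?_
        simp only [mul_pow]
        nlinarith [sq_nonneg (w p ^ 2 - w q ^ 2)]
    _ = _ := by
        rw [integral_const_mul, integral_add hp hq,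
          integral_comp_eval v p (f := fun x => x ^ 4) (by fun_prop),
          integral_comp_eval v q (f := fun x => x ^ 4) (by fun_prop),
          integral_pow_four_gaussianReal]
        ring

end Moments

section Gram

variable {a m : ℕ}

/-- The Gram matrix of the rows of a weight matrix. -/
def rowGram (w : Fin a × Fin m → ℝ) : Matrix (Fin a) (Fin a) ℝ :=
  Matrix.of fun k l => ∑ i, w (k, i) * w (l, i)

theorem measure_gram_apply_le (v : ℝ≥0) (hv : (v : ℝ) * m = 1) (k l : Fin a) {η : ℝ} (hη : 0 < η) :
    (Measure.pi fun _ : Fin a × Fin m => gaussianReal 0 v)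
        {w | η ≤ |rowGram w k l - (1 : Matrix (Fin a) (Fin a) ℝ) k l|}
      ≤ ENNReal.ofReal (v * (∫ x, x ^ 4 ∂gaussianReal 0 1) / η ^ 2) := by
  set μ := Measure.pi fun _ : Fin a × Fin m => gaussianReal 0 v with hμ
  set X : Fin m → (Fin a × Fin m → ℝ) → ℝ := fun i w => w (k, i) * w (l, i) with hX
  have hmem : ∀ i ∈ Finset.univ, MemLp (X i) 2 μ := fun i _ => memLp_mul_eval v (k, i) (l, i)
  have hind : ((Finset.univ : Finset (Fin m)) : Set (Fin m)).Pairwise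
      fun i j => IndepFun (X i) (X j) μ := fun i _ j _ hij => by
    have h := (iIndepFun_eval (ι := Fin a × Fin m) v).indepFun_prodMk_prodMk
      (fun p => measurable_pi_apply p) (k, i) (l, i) (k, j) (l, j) (by simp [hij]) (by simp [hij])
      (by simp [hij]) (by simp [hij])
    exact h.comp (φ := fun x : ℝ × ℝ => x.1 * x.2) (ψ := fun x : ℝ × ℝ => x.1 * x.2)
      (by fun_prop) (by fun_prop)
  have hsum : (∑ i, X i) = fun w => rowGram w k l := by
    ext w; simp [hX, rowGram]
  have hvar : Var[fun w => rowGram w k l; μ] ≤ v * ∫ x, x ^ 4 ∂gaussianReal 0 1 := by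
    rw [← hsum, IndepFun.variance_sum hmem hind]
    calc ∑ i, Var[X i; μ] ≤ ∑ _i : Fin m, (v : ℝ) ^ 2 * ∫ x, x ^ 4 ∂gaussianReal 0 1 :=
          Finset.sum_le_sum fun i hi =>
            (variance_le_expectation_sq (hmem i hi).aestronglyMeasurable).trans
              (integral_mul_eval_sq_le v (k, i) (l, i))
      _ = v * m * (v * ∫ x, x ^ 4 ∂gaussianReal 0 1) := by
          simp only [Finset.sum_const, Finset.card_univ, Fintype.card_fin, nsmul_eq_mul]; ring
      _ = _ := by rw [hv, one_mul]
  have hmean : ∫ w, rowGram w k l ∂μ = (1 : Matrix (Fin a) (Fin a) ℝ) k l := by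
    have hi : ∀ i, ∫ w, X i w ∂μ = if k = l then (v : ℝ) else 0 := fun i => by
      simp only [hX, hμ, integral_mul_eval, Prod.mk.injEq, and_true]
    have he : ∀ w : Fin a × Fin m → ℝ, rowGram w k l = ∑ i, X i w := fun w => rfl
    simp only [he]
    rw [integral_finsetSum _ fun i hi => (hmem i hi).integrable (by norm_num)]
    simp only [hi, Finset.sum_const, Finset.card_univ, Fintype.card_fin, nsmul_eq_mul,
      Matrix.one_apply]
    split_ifs
    · linarith
    · simp
  have hL : MemLp (fun w => rowGram w k l) 2 μ := by
    rw [← hsum]; exact memLp_finsetSum' _ hmem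
  have h := meas_ge_le_variance_div_sq hL hη
  rw [hmean] at h
  refine h.trans (ENNReal.ofReal_le_ofReal ?_)
  gcongr

/-- The Gram matrix of a wide Gaussian matrix with normalized rows is close to the identity. -/
theorem tendsto_measure_gram (a : ℕ) {η : ℝ} (hη : 0 < η) :
    Tendsto (fun m : ℕ => (Measure.pi fun _ : Fin a × Fin m => gaussianReal 0 (m : ℝ≥0)⁻¹)
      {w | ∃ k l, η ≤ |rowGram w k l - (1 : Matrix (Fin a) (Fin a) ℝ) k l|}) atTop (nhds 0) := by
  set C := ∫ x, x ^ 4 ∂gaussianReal 0 1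
  have hb : Tendsto (fun m : ℕ => ∑ _k : Fin a, ∑ _l : Fin a,
      ENNReal.ofReal (((m : ℝ≥0)⁻¹ : ℝ≥0) * C / η ^ 2)) atTop (nhds 0) := by
    have h1 : Tendsto (fun m : ℕ => ENNReal.ofReal (((m : ℝ≥0)⁻¹ : ℝ≥0) * C / η ^ 2)) atTop
        (nhds 0) := by
      rw [← ENNReal.ofReal_zero]
      refine ENNReal.tendsto_ofReal ?_
      have := ((tendsto_inv_atTop_nhds_zero_nat (𝕜 := ℝ)).mul_const C).div_const (η ^ 2)
      simpa using this
    have h2 := tendsto_finsetSum (Finset.univ : Finset (Fin a)) fun _ _ =>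
      tendsto_finsetSum (Finset.univ : Finset (Fin a)) fun _ _ => h1
    simpa using h2
  refine tendsto_of_tendsto_of_tendsto_of_le_of_le' tendsto_const_nhds hb
    (.of_forall fun _ => zero_le) ?_
  filter_upwards [eventually_gt_atTop 0] with m hm
  have hv : (((m : ℝ≥0)⁻¹ : ℝ≥0) : ℝ) * m = 1 := by
    have : (m : ℝ) ≠ 0 := by exact_mod_cast hm.ne'
    push_cast
    field_simp
  simp only [Set.ofPred_exists]
  refine (measure_iUnion_fintype_le _ _).trans (Finset.sum_le_sum fun k _ => ?_)
  refine (measure_iUnion_fintype_le _ _).trans (Finset.sum_le_sum fun l _ => ?_)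
  exact measure_gram_apply_le _ hv k l hη

end Gram

section GaussianImage

variable {d m n : ℕ}

theorem charFunDual_inputMeasure_map (V : Matrix (Fin n) (Fin d) ℝ)
    (L : StrongDual ℝ (Fin n → ℝ)) :
    charFunDual ((inputMeasure d).map fun x => V *ᵥ x) L
      = Complex.exp (-(((fun i => L (Pi.single i 1)) ⬝ᵥ
          (V * Vᵀ) *ᵥ fun i => L (Pi.single i 1) : ℝ) : ℂ) / 2) := by
  set ℓ : Fin n → ℝ := fun i => L (Pi.single i 1) with hℓ
  have hL : ∀ y, L y = ℓ ⬝ᵥ y := fun y => by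
    conv_lhs => rw [← Finset.univ_sum_single y]
    rw [map_sum, dotProduct]
    refine Finset.sum_congr rfl fun i _ => ?_
    have : (Pi.single i (y i) : Fin n → ℝ) = y i • Pi.single i 1 := by
      rw [← Pi.single_smul]; simp
    rw [this, map_smul, smul_eq_mul, mul_comm]
  have h1 := charFunDual_map (μ := inputMeasure d) (LinearMap.toContinuousLinearMap V.mulVecLin) L
  have h2 : (⇑(LinearMap.toContinuousLinearMap V.mulVecLin) : (Fin d → ℝ) → Fin n → ℝ)
      = fun x => V *ᵥ x := by
    ext x; simp
  rw [h2] at h1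
  rw [h1, inputMeasure, charFunDual_pi]
  have h3 : ∀ j : Fin d, charFunDual (gaussianReal 0 1)
      ((L ∘SL LinearMap.toContinuousLinearMap V.mulVecLin) ∘SL
        ContinuousLinearMap.single ℝ (fun _ : Fin d => ℝ) j)
      = Complex.exp (-(((ℓ ᵥ* V) j * (ℓ ᵥ* V) j : ℝ) : ℂ) / 2) := fun j => by
    have h4 : charFun (gaussianReal 0 1) ((ℓ ᵥ* V) j)
        = Complex.exp (-(((ℓ ᵥ* V) j * (ℓ ᵥ* V) j : ℝ) : ℂ) / 2) := by
      rw [charFun_gaussianReal]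
      congr 1
      push_cast
      ring
    rw [← h4, charFun_apply_real, charFunDual_apply]
    refine integral_congr_ae (.of_forall fun x => ?_)
    simp [hL, mul_comm]
    rfl
  simp only [h3]
  rw [← Complex.exp_sum]
  congr 1
  rw [← Finset.sum_div, Finset.sum_neg_distrib, ← Complex.ofReal_sum, ← Matrix.mulVec_mulVec,
    dotProduct_mulVec, Matrix.mulVec_transpose, dotProduct]

theorem measurable_mulVec (V : Matrix (Fin n) (Fin d) ℝ) :
    Measurable fun x : Fin d → ℝ => V *ᵥ x := by
  refine measurable_pi_iff.2 fun i => ?_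
  simp only [Matrix.mulVec, dotProduct]
  fun_prop

/-- The law of a linear image of a standard Gaussian depends only on its covariance. -/
theorem inputMeasure_map_mulVec_eq {V : Matrix (Fin n) (Fin d) ℝ} {S : Matrix (Fin n) (Fin m) ℝ}
    (h : V * Vᵀ = S * Sᵀ) :
    (inputMeasure d).map (fun x => V *ᵥ x) = (inputMeasure m).map fun x => S *ᵥ x := by
  have := Measure.isProbabilityMeasure_map (μ := inputMeasure d) (measurable_mulVec V).aemeasurable
  have := Measure.isProbabilityMeasure_map (μ := inputMeasure m) (measurable_mulVec S).aemeasurable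
  refine Measure.ext_of_charFunDual (funext fun L => ?_)
  rw [charFunDual_inputMeasure_map, charFunDual_inputMeasure_map, h]

open scoped MatrixOrder in
theorem exists_sqrt_sub_one_sq_le {K : Matrix (Fin n) (Fin n) ℝ} (hK : K.PosSemidef) :
    ∃ S : Matrix (Fin n) (Fin n) ℝ, S * Sᵀ = K ∧
      ∑ i, ∑ j, (S - 1) i j ^ 2 ≤ ∑ i, ∑ j, (K - 1) i j ^ 2 := by
  set S := CFC.sqrt K with hS
  have hSp : S.PosSemidef := (CFC.sqrt_nonneg K).posSemidef
  have hSt : Sᵀ = S := hSp.isHermitian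
  have hSS : S * S = K := CFC.sqrt_mul_sqrt_self K hK.nonneg
  refine ⟨S, by rw [hSt, hSS], ?_⟩
  have hsq : ∀ A : Matrix (Fin n) (Fin n) ℝ, Aᵀ = A → ∑ i, ∑ j, A i j ^ 2 = (A * A).trace :=
    fun A hA => by
      simp only [Matrix.trace, Matrix.diag_apply, Matrix.mul_apply]
      refine Finset.sum_congr rfl fun i _ => Finset.sum_congr rfl fun j _ => ?_
      rw [sq, ← Matrix.transpose_apply A i j, hA]
  have hS1 : (S - 1)ᵀ = S - 1 := by rw [Matrix.transpose_sub, hSt, Matrix.transpose_one]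
  have hK1 : (K - 1)ᵀ = K - 1 := by
    rw [← hSS, Matrix.transpose_sub, Matrix.transpose_mul, hSt, Matrix.transpose_one]
  rw [hsq _ hS1, hsq _ hK1, ← sub_nonneg, ← Matrix.trace_sub]
  have hd : (K - 1) * (K - 1) - (S - 1) * (S - 1) = (S - 1)ᴴ * (K + (S + S)) * (S - 1) := by
    have : (S - 1)ᴴ = S - 1 := hS1
    rw [this, ← hSS]
    noncomm_ring
  rw [hd]
  exact ((hK.add (hSp.add hSp)).conjTranspose_mul_mul_same _).trace_nonneg

end GaussianImage

section Perturbation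

variable {c n : ℕ}

theorem continuousAt_meanHess_map (w : Fin c × Fin n → ℝ) (i j : Fin n) :
    ContinuousAt (fun S : Matrix (Fin n) (Fin n) ℝ =>
      meanHess ((inputMeasure n).map fun u => S *ᵥ u) w i j) 1 := by
  have he : ∀ S : Matrix (Fin n) (Fin n) ℝ,
      meanHess ((inputMeasure n).map fun u => S *ᵥ u) w i j
        = ∫ u, gateHess w (S *ᵥ u) i j ∂inputMeasure n := fun S => by
    simp only [meanHess, Matrix.of_apply]
    exact integral_map (measurable_mulVec S).aemeasurable
      (measurable_gateHess_right w i j).aestronglyMeasurable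
  simp only [he]
  have : FirstCountableTopology (Matrix (Fin n) (Fin n) ℝ) :=
    inferInstanceAs (FirstCountableTopology (Fin n → Fin n → ℝ))
  refine continuousAt_of_dominated (bound := fun _ => (∑ k, |w (k, i)|) * ∑ l, |w (l, j)|)
    (.of_forall fun S => ((measurable_gateHess_right w i j).comp
      (measurable_mulVec S)).aestronglyMeasurable)
    (.of_forall fun S => .of_forall fun u => abs_gateHess_le w _ i j) (integrable_const _) ?_
  filter_upwards [ae_inputMeasure_ne_zero] with u hu
  have hS : ContinuousAt (fun S : Matrix (Fin n) (Fin n) ℝ => S *ᵥ u) 1 :=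
    Continuous.continuousAt (by fun_prop)
  have hSi : ∀ i, ContinuousAt (fun S : Matrix (Fin n) (Fin n) ℝ => gate ((S *ᵥ u) i)) 1 :=
    fun i => by
      refine ContinuousAt.comp (g := gate) (f := fun S : Matrix (Fin n) (Fin n) ℝ => (S *ᵥ u) i)
        (continuousAt_gate ?_) ((continuous_apply i).continuousAt.comp hS)
      simpa using hu i
  have hA : ∀ k l, ContinuousAt (fun S : Matrix (Fin n) (Fin n) ℝ =>
      Amat (readout w (S *ᵥ u)) k l) 1 := fun k l =>
    Continuous.continuousAt
      (((continuous_Amat_apply k l).comp (continuous_readout w)).comp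
        (show Continuous fun S : Matrix (Fin n) (Fin n) ℝ => S *ᵥ u by fun_prop))
  simp only [gateHess_apply]
  have h := hSi i
  have h' := hSi j
  fun_prop

/-- Whether the ratio of two eigenvalues of the mean Hessian is below `ε` is unaffected by a small
perturbation of the covariance of the pre-activations, off a level set. -/
theorem exists_ratio_lt_iff (w : Fin c × Fin n → ℝ) {ε : ℝ} {a b : Fin n}
    (hba : b ≤ a) (hne : sortedEig (meanHess (inputMeasure n) w) a
      ≠ ε * sortedEig (meanHess (inputMeasure n) w) b) :
    ∃ η > 0, ∀ S : Matrix (Fin n) (Fin n) ℝ, (∀ i j, |(S - 1) i j| < η) →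
      (sortedEig (meanHess ((inputMeasure n).map fun u => S *ᵥ u) w) a
          / sortedEig (meanHess ((inputMeasure n).map fun u => S *ᵥ u) w) b < ε ↔
        sortedEig (meanHess (inputMeasure n) w) a
          / sortedEig (meanHess (inputMeasure n) w) b < ε) := by
  set F : Matrix (Fin n) (Fin n) ℝ → Matrix (Fin n) (Fin n) ℝ := fun S =>
    meanHess ((inputMeasure n).map fun u => S *ᵥ u) w with hF
  have hF1 : F 1 = meanHess (inputMeasure n) w := by
    simp [hF, Measure.map_id']
  rw [← hF1] at hne ⊢
  have hFc : ContinuousAt F 1 :=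
    continuousAt_pi.2 fun i => continuousAt_pi.2 fun j => continuousAt_meanHess_map w i j
  have hcont : ∀ k, ContinuousAt (fun S => sortedEig (F S) k) 1 := fun k =>
    ContinuousAt.comp (g := fun M => sortedEig M k) (continuous_sortedEig k).continuousAt hFc
  have h0 : ∀ k, 0 ≤ sortedEig (F 1) k := fun k => by
    rw [hF1]; exact sortedEig_nonneg (meanHess_nonneg _ w) k
  have hle : sortedEig (F 1) a ≤ sortedEig (F 1) b := antitone_sortedEig _ hba
  have hb : sortedEig (F 1) b ≠ 0 := fun hb => by
    have : sortedEig (F 1) a = 0 := le_antisymm (hb ▸ hle) (h0 a)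
    exact hne (by rw [this, hb, mul_zero])
  have hr : ContinuousAt (fun S => sortedEig (F S) a / sortedEig (F S) b) 1 := (hcont a).div (hcont b) hb
  have hrne : sortedEig (F 1) a / sortedEig (F 1) b ≠ ε := fun h => hne (by
    rw [← h, div_mul_cancel₀ _ hb])
  have hev : ∀ᶠ S in nhds (1 : Matrix (Fin n) (Fin n) ℝ),
      (sortedEig (F S) a / sortedEig (F S) b < ε ↔ sortedEig (F 1) a / sortedEig (F 1) b < ε) := by
    rcases lt_or_gt_of_ne hrne with h | h
    · filter_upwards [hr.eventually_lt_const h] with S hS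
      exact iff_of_true hS h
    · filter_upwards [hr.eventually_const_lt h] with S hS
      exact iff_of_false hS.not_gt h.not_gt
  obtain ⟨η, hη, h⟩ := Metric.eventually_nhds_iff (α := Fin n → Fin n → ℝ).1 hev
  refine ⟨η, hη, fun S hS => h ?_⟩
  refine (dist_pi_lt_iff hη).2 fun i => (dist_pi_lt_iff hη).2 fun j => ?_
  rw [Real.dist_eq]
  exact hS i j

end Perturbation

section InnerLimit

variable {c n : ℕ}

theorem tendsto_measure_of_iff {Ω : ℕ → Type*} [∀ d, MeasurableSpace (Ω d)]
    (μ : ∀ d, Measure (Ω d)) [∀ d, IsProbabilityMeasure (μ d)] {A B : ∀ d, Set (Ω d)}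
    (hB : Tendsto (fun d => μ d (B d)) atTop (nhds 0)) (p : Prop) [Decidable p]
    (h : ∀ d, ∀ w, w ∉ B d → (w ∈ A d ↔ p)) :
    Tendsto (fun d => μ d (A d)) atTop (nhds (if p then 1 else 0)) := by
  split_ifs with hp
  · have h1 : Tendsto (fun d => 1 - μ d (B d)) atTop (nhds (1 - 0)) :=
      ENNReal.Tendsto.sub tendsto_const_nhds hB (.inl ENNReal.one_ne_top)
    rw [tsub_zero] at h1
    refine tendsto_of_tendsto_of_tendsto_of_le_of_le h1 tendsto_const_nhds (fun d => ?_)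
      fun d => prob_le_one
    rw [tsub_le_iff_right, ← measure_univ (μ := μ d)]
    refine (measure_mono fun w _ => ?_).trans (measure_union_le _ _)
    by_cases hw : w ∈ B d
    · exact .inr hw
    · exact .inl ((h d w hw).2 hp)
  · exact tendsto_of_tendsto_of_tendsto_of_le_of_le tendsto_const_nhds hB (fun d => zero_le)
      fun d => measure_mono fun w hw => by_contra fun hB => hp ((h d w hB).1 hw)

theorem tendsto_measure_ratio_lt (w : Fin c × Fin n → ℝ) {ε : ℝ} {a b : Fin n}
    (hba : b ≤ a) (hne : sortedEig (meanHess (inputMeasure n) w) a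
      ≠ ε * sortedEig (meanHess (inputMeasure n) w) b) :
    Tendsto (fun d : ℕ => (Measure.pi fun _ : Fin n × Fin d => gaussianReal 0 (d : ℝ≥0)⁻¹)
        {v | sortedEig (meanHess ((inputMeasure d).map fun x => W1of v *ᵥ x) w) a
          / sortedEig (meanHess ((inputMeasure d).map fun x => W1of v *ᵥ x) w) b < ε}) atTop
      (nhds ({w | sortedEig (meanHess (inputMeasure n) w) a
          / sortedEig (meanHess (inputMeasure n) w) b < ε}.indicator (fun _ => 1) w)) := by
  classical
  obtain ⟨η, hη, h⟩ := exists_ratio_lt_iff w hba hne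
  have hη' : 0 < η / (n + 1) := by positivity
  rw [Set.indicator_apply]
  refine tendsto_measure_of_iff _ (tendsto_measure_gram n hη') _ fun d v hv => ?_
  simp only [Set.mem_ofPred_eq, not_exists, not_le] at hv
  have hK : (W1of v * (W1of v)ᵀ).PosSemidef := by
    simpa using Matrix.posSemidef_self_mul_conjTranspose (W1of v)
  obtain ⟨S, hS, hSle⟩ := exists_sqrt_sub_one_sq_le hK
  rw [Set.mem_ofPred_eq, Set.mem_ofPred_eq, inputMeasure_map_mulVec_eq hS.symm]
  refine h S fun i j => ?_
  have h1 : ∑ i, ∑ j, (W1of v * (W1of v)ᵀ - (1 : Matrix (Fin n) (Fin n) ℝ)) i j ^ 2 ≤ (n * (η / (n + 1))) ^ 2 := by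
    calc _ ≤ ∑ _i : Fin n, ∑ _j : Fin n, (η / (n + 1)) ^ 2 :=
          Finset.sum_le_sum fun i _ => Finset.sum_le_sum fun j _ =>
            sq_le_sq' (abs_lt.1 (hv i j)).1.le (abs_lt.1 (hv i j)).2.le
      _ = _ := by simp; ring
  have h2 : (S - 1) i j ^ 2 ≤ ∑ i, ∑ j, (S - 1) i j ^ 2 :=
    (Finset.single_le_sum (f := fun j => (S - 1) i j ^ 2) (fun j _ => sq_nonneg _)
      (Finset.mem_univ j)).trans
      (Finset.single_le_sum (f := fun i => ∑ j, (S - 1) i j ^ 2)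
        (fun i _ => Finset.sum_nonneg fun j _ => sq_nonneg _) (Finset.mem_univ i))
  refine (abs_le_of_sq_le_sq (h2.trans (hSle.trans h1)) (by positivity)).trans_lt ?_
  rw [← mul_div_assoc, div_lt_iff₀ (by positivity)]
  nlinarith

theorem measurable_outputHessian {d : ℕ} (i j : Fin n) :
    Measurable fun w : (Fin n × Fin d → ℝ) × (Fin c × Fin n → ℝ) =>
      outputHessian c d n w i j := by
  simp only [outputHessian, Matrix.of_apply, hessOne_eq]
  have h : Measurable fun p : ((Fin n × Fin d → ℝ) × (Fin c × Fin n → ℝ)) × (Fin d → ℝ) =>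
      gateHess p.1.2 (W1of p.1.1 *ᵥ p.2) i j := by
    refine Measurable.comp (g := fun q : (Fin c × Fin n → ℝ) × (Fin n → ℝ) =>
      gateHess q.1 q.2 i j) (f := fun p : ((Fin n × Fin d → ℝ) × (Fin c × Fin n → ℝ)) ×
        (Fin d → ℝ) => (p.1.2, W1of p.1.1 *ᵥ p.2)) (measurable_gateHess i j)
      (Measurable.prodMk (by fun_prop) (measurable_pi_iff.2 fun k => ?_))
    simp only [Matrix.mulVec, dotProduct, W1of, Matrix.of_apply]
    fun_prop
  exact h.stronglyMeasurable.integral_prod_right'.measurable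

theorem tendsto_weightMeasure_ratio_lt (hc : 2 ≤ c) {ε : ℝ} (hε : 0 < ε) {a b : Fin n}
    (hba : b < a) :
    Tendsto (fun d : ℕ => weightMeasure c d n
        {w | sortedEig (outputHessian c d n w) a / sortedEig (outputHessian c d n w) b < ε}) atTop
      (nhds ((Measure.pi fun _ : Fin c × Fin n => gaussianReal 0 (n : ℝ≥0)⁻¹)
        {w | sortedEig (meanHess (inputMeasure n) w) a
          / sortedEig (meanHess (inputMeasure n) w) b < ε})) := by
  have hmeas : ∀ d, MeasurableSet {w : (Fin n × Fin d → ℝ) × (Fin c × Fin n → ℝ) |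
      sortedEig (outputHessian c d n w) a / sortedEig (outputHessian c d n w) b < ε} := fun d =>
    measurableSet_lt ((measurable_sortedEig_comp measurable_outputHessian a).div
      (measurable_sortedEig_comp measurable_outputHessian b)) measurable_const
  have hmeas' : MeasurableSet {w : Fin c × Fin n → ℝ | sortedEig (meanHess (inputMeasure n) w) a
      / sortedEig (meanHess (inputMeasure n) w) b < ε} :=
    measurableSet_lt ((measurable_sortedEig_meanHess _ a).div (measurable_sortedEig_meanHess _ b))
      measurable_const
  simp only [weightMeasure, Measure.prod_apply_symm (hmeas _)]
  rw [← lintegral_indicator_one hmeas']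
  refine tendsto_lintegral_of_dominated_convergence (fun _ => 1)
    (fun d => measurable_measure_prodMk_right (hmeas d))
    (fun d => .of_forall fun w => prob_le_one) (by simp) ?_
  have hn : (n : ℝ≥0)⁻¹ ≠ 0 := by
    have : n ≠ 0 := (Nat.zero_le _).trans_lt a.isLt |>.ne'
    positivity
  filter_upwards [(pi_gaussianReal_absolutelyContinuous hn).ae_le
    (measure_eq_zero_iff_ae_notMem.1 (volume_sortedEig_ratio_eq_zero hc hε hba.ne'))] with w hw
  have := tendsto_measure_ratio_lt w hba.le hw
  simp only [Set.preimage_ofPred_eq, outputHessian_eq_meanHess]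
  exact this

end InnerLimit

section Residual

variable {c n : ℕ}

/-- The expectation of `Amat` at the logits. -/
noncomputable def meanAmat (w : Fin c × Fin n → ℝ) : Matrix (Fin c) (Fin c) ℝ :=
  Matrix.of fun k l => ∫ u, Amat (readout w u) k l ∂inputMeasure n

/-- The difference between the mean Hessian and its approximation with decoupled gates. -/
noncomputable def hessResidual (w : Fin c × Fin n → ℝ) : Matrix (Fin n) (Fin n) ℝ :=
  Matrix.of fun i j => meanHess (inputMeasure n) w i j
    - 1 / 4 * ∑ k, ∑ l, w (k, i) * w (l, j) * meanAmat w k l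

theorem measurable_Amat_readout_right (w : Fin c × Fin n → ℝ) (k l : Fin c) :
    Measurable fun u : Fin n → ℝ => Amat (readout w u) k l :=
  ((continuous_Amat_apply k l).comp (continuous_readout w)).measurable

theorem integrable_Amat_readout (w : Fin c × Fin n → ℝ) (k l : Fin c) :
    Integrable (fun u => Amat (readout w u) k l) (inputMeasure n) :=
  Integrable.of_bound (measurable_Amat_readout_right w k l).aestronglyMeasurable 1
    (.of_forall fun _ => abs_Amat_le_one _ k l)

theorem integrable_abs_eval (i : Fin n) : Integrable (fun u => |u i|) (inputMeasure n) :=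
  integrable_comp_eval 1 i (f := fun x => |x|) (by simpa using integrable_abs_pow_gaussianReal 1 1)

theorem integral_abs_eval_le (i : Fin n) : ∫ u, |u i| ∂inputMeasure n ≤ 1 := by
  have h1 : ∫ u, |u i| ∂inputMeasure n = ∫ x, |x| ∂gaussianReal 0 1 :=
    integral_comp_eval 1 i (f := fun x => |x|) (by fun_prop)
  have h2 : ∫ x, |x| ∂gaussianReal 0 1 ≤ ∫ x, (1 + x ^ 2) / 2 ∂gaussianReal 0 1 := by
    refine integral_mono (by simpa using integrable_abs_pow_gaussianReal 1 1)
      (((integrable_const _).add (integrable_sq_gaussianReal 1)).div_const 2) fun x => ?_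
    have := sq_nonneg (|x| - 1)
    have := sq_abs x
    simp only
    nlinarith
  rw [h1]
  refine h2.trans_eq ?_
  rw [integral_div, integral_add (integrable_const _) (integrable_sq_gaussianReal 1),
    integral_sq_gaussianReal]
  simp

theorem abs_Amat_readout_negCoord_le (w : Fin c × Fin n → ℝ) (k l : Fin c) (i : Fin n)
    (u : Fin n → ℝ) :
    |Amat (readout w u) k l - Amat (readout w (negCoord i u)) k l|
      ≤ 6 * (∑ m, |w (m, i)|) * |u i| := by
  refine (abs_Amat_sub_le _ _ k l).trans ?_
  rw [mul_assoc, Finset.sum_mul]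
  refine mul_le_mul_of_nonneg_left (Finset.sum_le_sum fun m _ => ?_) (by norm_num)
  have h : readout w u m - readout w (negCoord i u) m
      = w (m, i) * (max (u i) 0 - max (-u i) 0) := by
    simp only [readout, Matrix.mulVec, dotProduct, W2of, Matrix.of_apply, ← Finset.sum_sub_distrib,
      ← mul_sub, negCoord]
    rw [Finset.sum_eq_single i]
    · simp
    · intro j _ hj; simp [hj]
    · simp
  rw [h, abs_mul, max_zero_sub_max_neg_zero_eq_self]

theorem integral_abs_Amat_readout_negCoord_le (w : Fin c × Fin n → ℝ) (k l : Fin c) (i : Fin n) :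
    ∫ u, |Amat (readout w u) k l - Amat (readout w (negCoord i u)) k l| ∂inputMeasure n
      ≤ 6 * ∑ m, |w (m, i)| := by
  have h0 : 0 ≤ 6 * ∑ m, |w (m, i)| := by positivity
  calc _ ≤ ∫ u, 6 * (∑ m, |w (m, i)|) * |u i| ∂inputMeasure n :=
        integral_mono_of_nonneg (.of_forall fun _ => abs_nonneg _)
          ((integrable_abs_eval i).const_mul _)
          (.of_forall fun u => abs_Amat_readout_negCoord_le w k l i u)
    _ = 6 * (∑ m, |w (m, i)|) * ∫ u, |u i| ∂inputMeasure n := integral_const_mul _ _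
    _ ≤ _ := mul_le_of_le_one_right h0 (integral_abs_eval_le i)

theorem hessResidual_apply (w : Fin c × Fin n → ℝ) (i j : Fin n) :
    hessResidual w i j = ∑ k, ∑ l, w (k, i) * w (l, j) *
      (∫ u, gate (u i) * gate (u j) * Amat (readout w u) k l ∂inputMeasure n
        - 1 / 4 * ∫ u, Amat (readout w u) k l ∂inputMeasure n) := by
  have h := fun k l => integrable_gate_gate_Amat w 1 i j k l
  simp only [one_smul] at h
  simp only [hessResidual, meanHess, meanAmat, Matrix.of_apply, gateHess_apply]
  rw [integral_finsetSum _ fun k _ => integrable_finsetSum _ fun l _ => (h k l).const_mul _,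
    Finset.mul_sum, ← Finset.sum_sub_distrib]
  refine Finset.sum_congr rfl fun k _ => ?_
  rw [integral_finsetSum _ fun l _ => (h k l).const_mul _, Finset.mul_sum,
    ← Finset.sum_sub_distrib]
  refine Finset.sum_congr rfl fun l _ => ?_
  rw [integral_const_mul]
  ring

theorem abs_hessResidual_le (w : Fin c × Fin n → ℝ) (i j : Fin n) {C : ℝ}
    (hC : ∀ k l, |∫ u, gate (u i) * gate (u j) * Amat (readout w u) k l ∂inputMeasure n
        - 1 / 4 * ∫ u, Amat (readout w u) k l ∂inputMeasure n| ≤ C) :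
    |hessResidual w i j| ≤ (∑ k, |w (k, i)|) * (∑ k, |w (k, j)|) * C := by
  rw [hessResidual_apply, Finset.sum_mul_sum, Finset.sum_mul]
  refine (Finset.abs_sum_le_sum_abs _ _).trans (Finset.sum_le_sum fun k _ => ?_)
  rw [Finset.sum_mul]
  refine (Finset.abs_sum_le_sum_abs _ _).trans (Finset.sum_le_sum fun l _ => ?_)
  rw [abs_mul, abs_mul]
  exact mul_le_mul_of_nonneg_left (hC k l) (by positivity)

theorem hessResidual_sq_le (w : Fin c × Fin n → ℝ) (i j : Fin n) :
    hessResidual w i j ^ 2 ≤ 72 * ((∑ k, |w (k, i)|) ^ 4 * (∑ k, |w (k, j)|) ^ 2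
        + (∑ k, |w (k, i)|) ^ 2 * (∑ k, |w (k, j)|) ^ 4)
      + if i = j then 4 * (∑ k, |w (k, i)|) ^ 4 else 0 := by
  rw [← sq_abs (hessResidual w i j)]
  split_ifs with hij
  · subst hij
    have h := abs_hessResidual_le w i i (C := 2) fun k l => by
      have h1 : |∫ u, gate (u i) * gate (u i) * Amat (readout w u) k l ∂inputMeasure n| ≤ 1 := by
        simpa using norm_integral_le_of_norm_le_const (μ := inputMeasure n)
          (f := fun u => gate (u i) * gate (u i) * Amat (readout w u) k l) (C := 1)
          (.of_forall fun u => abs_gate_gate_Amat_le _ _ _ _ _)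
      have h2 : |∫ u, Amat (readout w u) k l ∂inputMeasure n| ≤ 1 := by
        simpa using norm_integral_le_of_norm_le_const (μ := inputMeasure n)
          (f := fun u => Amat (readout w u) k l) (C := 1)
          (.of_forall fun u => abs_Amat_le_one _ _ _)
      rw [abs_le] at *
      constructor <;> linarith
    have ha : 0 ≤ ∑ k, |w (k, i)| := by positivity
    generalize ∑ k, |w (k, i)| = a at *
    have := pow_le_pow_left₀ (abs_nonneg _) h 2
    have : 0 ≤ a ^ 4 * a ^ 2 := by positivity
    nlinarith
  · have h := abs_hessResidual_le w i j fun k l =>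
      (abs_integral_gate_gate_sub_le hij (measurable_Amat_readout_right w k l)
        (fun u => abs_Amat_le_one _ _ _)).trans (add_le_add
          (integral_abs_Amat_readout_negCoord_le w k l i)
          (integral_abs_Amat_readout_negCoord_le w k l j))
    have h1 := pow_le_pow_left₀ (abs_nonneg _) h 2
    generalize ∑ k, |w (k, i)| = a at *
    generalize ∑ k, |w (k, j)| = b at *
    nlinarith [mul_nonneg (mul_nonneg (sq_nonneg a) (sq_nonneg b)) (sq_nonneg (a - b))]

theorem sum_hessResidual_sq_le (w : Fin c × Fin n → ℝ) :
    ∑ i, ∑ j, hessResidual w i j ^ 2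
      ≤ (144 * (c * ∑ k, rowGram w k k) + 4) * (c ^ 3 * ∑ p, w p ^ 4) := by
  set a : Fin n → ℝ := fun i => ∑ k, |w (k, i)| with ha
  have h1 : ∑ i, ∑ j, hessResidual w i j ^ 2
      ≤ (144 * ∑ i, a i ^ 2 + 4) * ∑ i, a i ^ 4 := by
    calc _ ≤ ∑ i, ∑ j, (72 * (a i ^ 4 * a j ^ 2 + a i ^ 2 * a j ^ 4)
            + if i = j then 4 * a i ^ 4 else 0) :=
          Finset.sum_le_sum fun i _ => Finset.sum_le_sum fun j _ => hessResidual_sq_le w i j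
      _ = _ := by
          simp only [Finset.sum_add_distrib, mul_add, ← Finset.mul_sum, Finset.sum_ite_eq,
            Finset.mem_univ, if_true, ← Finset.sum_mul]
          ring
  have h2 : ∑ i, a i ^ 2 ≤ c * ∑ k, rowGram w k k := by
    simp only [rowGram, Matrix.of_apply]
    rw [Finset.sum_comm, Finset.mul_sum]
    refine Finset.sum_le_sum fun i _ => ?_
    simpa [← sq] using sq_sum_le_card_mul_sum_sq (s := Finset.univ) (f := fun k => |w (k, i)|)
  have h3 : ∑ i, a i ^ 4 ≤ c ^ 3 * ∑ p, w p ^ 4 := by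
    rw [Fintype.sum_prod_type, Finset.sum_comm, Finset.mul_sum]
    refine Finset.sum_le_sum fun i _ => ?_
    have e1 := sq_sum_le_card_mul_sum_sq (s := Finset.univ) (f := fun k => |w (k, i)|)
    have e2 := sq_sum_le_card_mul_sum_sq (s := Finset.univ) (f := fun k => |w (k, i)| ^ 2)
    simp only [Finset.card_univ, Fintype.card_fin, sq_abs] at e1 e2
    calc a i ^ 4 = (a i ^ 2) ^ 2 := by ring
      _ ≤ (c * ∑ k, w (k, i) ^ 2) ^ 2 := pow_le_pow_left₀ (sq_nonneg _) e1 2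
      _ = c ^ 2 * (∑ k, w (k, i) ^ 2) ^ 2 := by ring
      _ ≤ c ^ 2 * (c * ∑ k, (w (k, i) ^ 2) ^ 2) := by gcongr
      _ = _ := by simp only [← pow_mul]; ring
  refine h1.trans (mul_le_mul (by linarith) h3 (by positivity) ?_)
  have : 0 ≤ ∑ i, a i ^ 2 := by positivity
  linarith

end Residual

section Moments

variable {c n : ℕ}

/-- Second moments of the rectified standard Gaussian vector. -/
noncomputable def reluMoment (i j : Fin n) : ℝ :=
  ∫ u, max (u i) 0 * max (u j) 0 ∂inputMeasure n

theorem memLp_relu (i : Fin n) : MemLp (fun u => max (u i) 0) 2 (inputMeasure n) := by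
  have hm : Measurable fun u : Fin n → ℝ => max (u i) 0 :=
    (measurable_pi_apply i).max measurable_const
  rw [memLp_two_iff_integrable_sq hm.aestronglyMeasurable]
  refine (integrable_comp_eval 1 i (integrable_sq_gaussianReal 1)).mono'
    (hm.pow_const 2).aestronglyMeasurable (.of_forall fun u => ?_)
  rw [Real.norm_eq_abs, abs_of_nonneg (sq_nonneg _)]
  refine sq_le_sq.2 ?_
  rw [abs_of_nonneg (le_max_right _ _)]
  exact max_le (le_abs_self _) (abs_nonneg _)

theorem reluMoment_self_le (i : Fin n) : reluMoment i i ≤ 1 := by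
  have h : ∫ u, u i ^ 2 ∂inputMeasure n = 1 := by
    have := integral_comp_eval 1 i (f := fun x => x ^ 2) (by fun_prop)
    rw [integral_sq_gaussianReal] at this
    simpa [inputMeasure] using this
  rw [← h]
  refine integral_mono ((memLp_relu i).integrable_mul (memLp_relu i))
    (integrable_comp_eval 1 i (integrable_sq_gaussianReal 1)) fun u => ?_
  rcases le_total (u i) 0 with hu | hu
  · simp [hu, sq_nonneg]
  · simp [hu, sq]

theorem memLp_readout (w : Fin c × Fin n → ℝ) (k : Fin c) :
    MemLp (fun u => readout w u k) 2 (inputMeasure n) := by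
  have h := memLp_finsetSum Finset.univ fun i (_ : i ∈ Finset.univ) =>
    (memLp_relu (n := n) i).const_mul (w (k, i))
  exact h

theorem integral_readout_sq (w : Fin c × Fin n → ℝ) (k : Fin c) :
    ∫ u, readout w u k ^ 2 ∂inputMeasure n
      = ∑ i, ∑ j, w (k, i) * w (k, j) * reluMoment i j := by
  have he : ∀ u, readout w u k ^ 2
      = ∑ i, ∑ j, w (k, i) * w (k, j) * (max (u i) 0 * max (u j) 0) := fun u => by
    simp only [readout, Matrix.mulVec, dotProduct, W2of, Matrix.of_apply, sq, Finset.sum_mul_sum]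
    exact Finset.sum_congr rfl fun i _ => Finset.sum_congr rfl fun j _ => by ring
  have hi : ∀ i j : Fin n, Integrable (fun u => max (u i) 0 * max (u j) 0) (inputMeasure n) :=
    fun i j => (memLp_relu i).integrable_mul (memLp_relu j)
  simp only [he]
  rw [integral_finsetSum _ fun i _ => integrable_finsetSum _ fun j _ => (hi i j).const_mul _]
  refine Finset.sum_congr rfl fun i _ => ?_
  rw [integral_finsetSum _ fun j _ => (hi i j).const_mul _]
  refine Finset.sum_congr rfl fun j _ => ?_
  rw [integral_const_mul, reluMoment]

end Moments

section Deterministic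

variable {c n : ℕ}

theorem form_meanHess (w : Fin c × Fin n → ℝ) (v : Fin n → ℝ) :
    v ⬝ᵥ meanHess (inputMeasure n) w *ᵥ v
      = 1 / 4 * ∑ k, ∑ l, (W2of w *ᵥ v) k * (W2of w *ᵥ v) l * meanAmat w k l
        + v ⬝ᵥ hessResidual w *ᵥ v := by
  have h : meanHess (inputMeasure n) w
      = (1 / 4 : ℝ) • ((W2of w)ᵀ * meanAmat w * W2of w) + hessResidual w := by
    ext i j
    simp only [hessResidual, Matrix.add_apply, Matrix.smul_apply, Matrix.of_apply, smul_eq_mul,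
      Matrix.mul_apply, Matrix.transpose_apply, W2of, Finset.sum_mul]
    rw [Finset.sum_comm (s := (Finset.univ : Finset (Fin c)))]
    simp only [mul_right_comm]
    ring
  have h2 : v ⬝ᵥ ((W2of w)ᵀ * meanAmat w * W2of w) *ᵥ v
      = (W2of w *ᵥ v) ⬝ᵥ meanAmat w *ᵥ (W2of w *ᵥ v) := by
    rw [← Matrix.mulVec_mulVec, ← Matrix.mulVec_mulVec, Matrix.dotProduct_mulVec,
      Matrix.vecMul_transpose]
  rw [h, Matrix.add_mulVec, dotProduct_add, Matrix.smul_mulVec, dotProduct_smul, h2, smul_eq_mul]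
  generalize W2of w *ᵥ v = a
  congr 2
  simp only [dotProduct, Matrix.mulVec, Finset.mul_sum]
  exact Finset.sum_congr rfl fun k _ => Finset.sum_congr rfl fun l _ => by ring

theorem form_meanAmat (w : Fin c × Fin n → ℝ) (a : Fin c → ℝ) :
    ∑ k, ∑ l, a k * a l * meanAmat w k l
      = ∫ u, ∑ k, ∑ l, a k * a l * Amat (readout w u) k l ∂inputMeasure n := by
  have h := integrable_Amat_readout w
  rw [integral_finsetSum _ fun k _ => integrable_finsetSum _ fun l _ => (h k l).const_mul _]
  refine Finset.sum_congr rfl fun k _ => ?_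
  rw [integral_finsetSum _ fun l _ => (h k l).const_mul _]
  refine Finset.sum_congr rfl fun l _ => ?_
  rw [integral_const_mul, meanAmat, Matrix.of_apply]

theorem le_form_meanAmat (hc : c ≠ 0) (w : Fin c × Fin n → ℝ) {B : ℝ} (hB : 0 < B)
    (hw : ∑ k, ∫ u, readout w u k ^ 2 ∂inputMeasure n ≤ B) {a : Fin c → ℝ} (ha : ∑ k, a k = 0) :
    Real.exp (-(2 * √(2 * B))) / (2 * c) * ∑ k, a k ^ 2 ≤ ∑ k, ∑ l, a k * a l * meanAmat w k l := by
  set q := Real.exp (-(2 * √(2 * B))) / c with hq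
  have hq0 : 0 ≤ q := by positivity
  have hz : Integrable (fun u => ∑ k, readout w u k ^ 2) (inputMeasure n) :=
    integrable_finsetSum _ fun k _ => (memLp_readout w k).integrable_sq
  have hr : √(2 * B) ^ 2 = 2 * B := Real.sq_sqrt (by positivity)
  have hpt : ∀ u, q * (1 - (∑ k, readout w u k ^ 2) / (2 * B)) * ∑ k, a k ^ 2
      ≤ ∑ k, ∑ l, a k * a l * Amat (readout w u) k l := fun u => by
    have hs : 0 ≤ ∑ k, readout w u k ^ 2 := by positivity
    have ha2 : 0 ≤ ∑ k, a k ^ 2 := by positivity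
    by_cases hle : ∑ k, readout w u k ^ 2 ≤ 2 * B
    · refine le_trans ?_ (le_sum_Amat_sq hc (readout w u) a ha hq0 fun k =>
        le_softmaxFn (readout w u) (fun m => ?_) k)
      · refine mul_le_mul_of_nonneg_right (mul_le_of_le_one_right hq0 ?_) ha2
        have : 0 ≤ (∑ k, readout w u k ^ 2) / (2 * B) := by positivity
        linarith
      · refine Real.abs_le_sqrt (le_trans ?_ hle)
        exact Finset.single_le_sum (f := fun k => readout w u k ^ 2) (fun k _ => sq_nonneg _)
          (Finset.mem_univ m)
    · refine le_trans ?_ (sum_Amat_sq_nonneg _ _)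
      refine mul_nonpos_of_nonpos_of_nonneg (mul_nonpos_of_nonneg_of_nonpos hq0 ?_) ha2
      have : 1 ≤ (∑ k, readout w u k ^ 2) / (2 * B) :=
        (one_le_div (by positivity)).2 (not_le.1 hle).le
      linarith
  rw [form_meanAmat]
  have h_int : ∫ u, q * (1 - (∑ k, readout w u k ^ 2) / (2 * B)) * ∑ k, a k ^ 2 ∂inputMeasure n
      = q * (1 - (∑ k, ∫ u, readout w u k ^ 2 ∂inputMeasure n) / (2 * B)) * ∑ k, a k ^ 2 := by
    rw [integral_mul_const, integral_const_mul, integral_sub (integrable_const _) (hz.div_const _),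
      integral_div, integral_finsetSum _ fun k _ => (memLp_readout w k).integrable_sq]
    simp
  refine le_trans ?_ ((h_int.symm.le).trans (integral_mono
    ((((integrable_const _).sub (hz.div_const _)).const_mul _).mul_const _)
    (integrable_finsetSum _ fun k _ => integrable_finsetSum _ fun l _ =>
      (integrable_Amat_readout w k l).const_mul _) hpt))
  refine mul_le_mul_of_nonneg_right ?_ (by positivity)
  have h1 : (∑ k, ∫ u, readout w u k ^ 2 ∂inputMeasure n) / (2 * B) ≤ 1 / 2 := by
    rw [div_le_iff₀ (by positivity)]
    linarith
  have h2 : Real.exp (-(2 * √(2 * B))) / (2 * c) = q * (1 / 2) := by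
    rw [hq]; field_simp
  rw [h2]
  exact mul_le_mul_of_nonneg_left (by linarith) hq0

theorem sortedEig_meanHess_le (hc : c ≠ 0) (w : Fin c × Fin n → ℝ) {ρ : ℝ} (hρ : 0 ≤ ρ)
    (hR : ∑ i, ∑ j, hessResidual w i j ^ 2 ≤ ρ ^ 2) (a : Fin n) (ha : (a : ℕ) = c - 1) :
    sortedEig (meanHess (inputMeasure n) w) a ≤ ρ := by
  obtain ⟨m, rfl⟩ := Nat.exists_eq_succ_of_ne_zero hc
  set f : (Fin n → ℝ) →ₗ[ℝ] (Fin m → ℝ) := LinearMap.pi fun k =>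
    LinearMap.proj k.succ ∘ₗ (W2of w).mulVecLin - LinearMap.proj 0 ∘ₗ (W2of w).mulVecLin with hf
  refine (isSpectrum_sortedEig (isHermitian_meanHess _ w)).ge_of_finrank (isHermitian_meanHess _ w)
    a (LinearMap.ker f) ?_ fun v hv => ?_
  · have h1 := LinearMap.finrank_range_add_finrank_ker f
    have h2 := Submodule.finrank_le (LinearMap.range f)
    rw [Module.finrank_fin_fun] at h1 h2
    omega
  · have hv' : ∀ k, (W2of w *ᵥ v) k = (W2of w *ᵥ v) 0 := fun k => by
      refine Fin.cases rfl (fun k => ?_) k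
      have := congrFun (LinearMap.mem_ker.1 hv) k
      simpa [hf, sub_eq_zero] using this
    rw [form_meanHess, form_meanAmat]
    simp only [sum_Amat_eq_zero_of_const hc _ _ _ hv', integral_zero, mul_zero, zero_add]
    refine (le_abs_self _).trans ((abs_dotProduct_mulVec_le _ v).trans ?_)
    refine mul_le_mul_of_nonneg_right (Real.sqrt_le_iff.2 ⟨hρ, hR⟩) ?_
    exact Finset.sum_nonneg fun i _ => mul_self_nonneg _

theorem rowGram_eq (w : Fin c × Fin n → ℝ) : rowGram w = W2of w * (W2of w)ᵀ := rfl

theorem dotProduct_le_rowGram_form {w : Fin c × Fin n → ℝ}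
    (hG : ∀ k l, |rowGram w k l - (1 : Matrix (Fin c) (Fin c) ℝ) k l| ≤ 1 / (2 * c))
    (b : Fin c → ℝ) : b ⬝ᵥ b ≤ 2 * (b ⬝ᵥ rowGram w *ᵥ b) := by
  have h0 : 0 ≤ b ⬝ᵥ b := Finset.sum_nonneg fun i _ => mul_self_nonneg _
  rcases Nat.eq_zero_or_pos c with rfl | hc
  · simp
  have hc' : (0 : ℝ) < c := by exact_mod_cast hc
  have h1 := abs_dotProduct_mulVec_le (rowGram w - 1) b
  have h2 : √(∑ i, ∑ j, (rowGram w - (1 : Matrix (Fin c) (Fin c) ℝ)) i j ^ 2) ≤ 1 / 2 := by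
    refine Real.sqrt_le_iff.2 ⟨by norm_num, ?_⟩
    calc _ ≤ ∑ _i : Fin c, ∑ _j : Fin c, (1 / (2 * c) : ℝ) ^ 2 :=
          Finset.sum_le_sum fun i _ => Finset.sum_le_sum fun j _ => by
            rw [← sq_abs]
            exact pow_le_pow_left₀ (abs_nonneg _) (hG i j) 2
      _ = _ := by
          simp only [Finset.sum_const, Finset.card_univ, Fintype.card_fin, nsmul_eq_mul]
          field_simp
  rw [Matrix.sub_mulVec, Matrix.one_mulVec, dotProduct_sub] at h1
  have := (abs_le.1 (h1.trans (mul_le_mul_of_nonneg_right h2 h0))).1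
  linarith

theorem le_sortedEig_meanHess (hc : 2 ≤ c) (w : Fin c × Fin n → ℝ) {ρ B : ℝ} (hρ : 0 ≤ ρ)
    (hR : ∑ i, ∑ j, hessResidual w i j ^ 2 ≤ ρ ^ 2)
    (hG : ∀ k l, |rowGram w k l - (1 : Matrix (Fin c) (Fin c) ℝ) k l| ≤ 1 / (2 * c))
    (hB : 0 < B) (hw : ∑ k, ∫ u, readout w u k ^ 2 ∂inputMeasure n ≤ B)
    (b : Fin n) (hb : (b : ℕ) = c - 2) :
    Real.exp (-(2 * √(2 * B))) / (16 * c) - ρ ≤ sortedEig (meanHess (inputMeasure n) w) b := by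
  have hc0 : c ≠ 0 := by omega
  set T : (Fin c → ℝ) →ₗ[ℝ] (Fin n → ℝ) := (W2of w)ᵀ.mulVecLin with hT
  have hWT : ∀ x, W2of w *ᵥ T x = rowGram w *ᵥ x := fun x => by
    rw [rowGram_eq, ← Matrix.mulVec_mulVec, hT, Matrix.mulVecLin_apply]
  have hTT : ∀ x, T x ⬝ᵥ T x = x ⬝ᵥ rowGram w *ᵥ x := fun x => by
    rw [← hWT, Matrix.dotProduct_mulVec, ← Matrix.mulVec_transpose]
    rfl
  have hinj : Function.Injective T := (injective_iff_map_eq_zero T).2 fun x hx => by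
    have h1 := dotProduct_le_rowGram_form hG x
    rw [← hTT, hx, dotProduct_zero, mul_zero] at h1
    exact dotProduct_self_eq_zero.1
      (le_antisymm h1 (Finset.sum_nonneg fun i _ => mul_self_nonneg _))
  set f : (Fin c → ℝ) →ₗ[ℝ] ℝ := ∑ k, LinearMap.proj k ∘ₗ (rowGram w).mulVecLin with hf
  refine (isSpectrum_sortedEig (isHermitian_meanHess _ w)).le_of_finrank (isHermitian_meanHess _ w)
    b ((LinearMap.ker f).map T) ?_ ?_
  · rw [← (Submodule.equivMapOfInjective T hinj (LinearMap.ker f)).finrank_eq]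
    have h1 := LinearMap.finrank_range_add_finrank_ker f
    have h2 := Submodule.finrank_le (LinearMap.range f)
    rw [Module.finrank_fin_fun] at h1
    rw [Module.finrank_self] at h2
    omega
  · rintro _ ⟨x, hx, rfl⟩
    have hsum : ∑ k, (W2of w *ᵥ T x) k = 0 := by
      have := LinearMap.mem_ker.1 hx
      simpa [hf, hWT] using this
    have h1 := le_form_meanAmat hc0 w hB hw hsum
    have h2 : T x ⬝ᵥ T x ≤ 2 * ∑ k, (W2of w *ᵥ T x) k ^ 2 := by
      have h3 := dotProduct_le_rowGram_form hG x
      have h4 : x ⬝ᵥ rowGram w *ᵥ x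
          ≤ 1 / 4 * (x ⬝ᵥ x) + ∑ k, (rowGram w *ᵥ x) k ^ 2 := by
        simp only [dotProduct, Finset.mul_sum, ← Finset.sum_add_distrib]
        refine Finset.sum_le_sum fun k _ => ?_
        nlinarith [sq_nonneg (1 / 2 * x k - (rowGram w *ᵥ x) k)]
      rw [hTT, hWT]
      linarith
    have h5 := (abs_le.1 ((abs_dotProduct_mulVec_le (hessResidual w) (T x)).trans
      (mul_le_mul_of_nonneg_right (Real.sqrt_le_iff.2 ⟨hρ, hR⟩)
        (Finset.sum_nonneg fun i _ => mul_self_nonneg _)))).1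
    rw [form_meanHess]
    have h6 : Real.exp (-(2 * √(2 * B))) / (16 * c) * (T x ⬝ᵥ T x)
        ≤ 1 / 4 * (Real.exp (-(2 * √(2 * B))) / (2 * c) * ∑ k, (W2of w *ᵥ T x) k ^ 2) := by
      have h7 : Real.exp (-(2 * √(2 * B))) / (16 * c)
          = 1 / 8 * (Real.exp (-(2 * √(2 * B))) / (2 * c)) := by field_simp; norm_num
      have h8 : 0 ≤ Real.exp (-(2 * √(2 * B))) / (2 * c) := by positivity
      rw [h7]
      nlinarith
    rw [sub_mul]
    linarith

/-- Deterministic conditions on the readout weights that force a small eigenvalue ratio. -/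
theorem ratio_lt_of_bounds (hc : 2 ≤ c) (w : Fin c × Fin n → ℝ) {ε ρ B : ℝ} (hε : 0 < ε)
    (hρ : 0 ≤ ρ) (hR : ∑ i, ∑ j, hessResidual w i j ^ 2 ≤ ρ ^ 2)
    (hG : ∀ k l, |rowGram w k l - (1 : Matrix (Fin c) (Fin c) ℝ) k l| ≤ 1 / (2 * c))
    (hB : 0 < B) (hw : ∑ k, ∫ u, readout w u k ^ 2 ∂inputMeasure n ≤ B)
    (hρε : ρ < ε * (Real.exp (-(2 * √(2 * B))) / (16 * c) - ρ))
    {a b : Fin n} (ha : (a : ℕ) = c - 1) (hb : (b : ℕ) = c - 2) :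
    sortedEig (meanHess (inputMeasure n) w) a / sortedEig (meanHess (inputMeasure n) w) b < ε := by
  have h1 := sortedEig_meanHess_le (by omega) w hρ hR a ha
  have h2 := le_sortedEig_meanHess hc w hρ hR hG hB hw b hb
  have h3 : 0 < Real.exp (-(2 * √(2 * B))) / (16 * c) - ρ :=
    pos_of_mul_pos_right (hρ.trans_lt hρε) hε.le
  rw [div_lt_iff₀ (h3.trans_le h2)]
  exact h1.trans_lt (hρε.trans_le (mul_le_mul_of_nonneg_left h2 hε.le))

end Deterministic

section OuterLimit

variable {c n : ℕ}

theorem measure_ge_le_ofReal_div {Ω : Type*} [MeasurableSpace Ω] {μ : Measure Ω}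
    [IsProbabilityMeasure μ] {f : Ω → ℝ} (hf : ∀ x, 0 ≤ f x) (hi : Integrable f μ) {t C : ℝ}
    (ht : 0 < t) (hC : ∫ x, f x ∂μ ≤ C) : μ {x | t ≤ f x} ≤ ENNReal.ofReal (C / t) := by
  rw [← ENNReal.ofReal_toReal (measure_ne_top μ _)]
  refine ENNReal.ofReal_le_ofReal ?_
  rw [le_div_iff₀ ht, mul_comm]
  exact (mul_meas_ge_le_integral_of_nonneg (.of_forall hf) hi t).trans hC

theorem measure_readout_sq_ge_le (hn : n ≠ 0) {B : ℝ} (hB : 0 < B) :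
    (Measure.pi fun _ : Fin c × Fin n => gaussianReal 0 (n : ℝ≥0)⁻¹)
        {w | B ≤ ∑ k, ∫ u, readout w u k ^ 2 ∂inputMeasure n} ≤ ENNReal.ofReal (c / B) := by
  set μ := Measure.pi fun _ : Fin c × Fin n => gaussianReal 0 (n : ℝ≥0)⁻¹ with hμ
  have hmul : ∀ p q : Fin c × Fin n, Integrable (fun w => w p * w q) μ := fun p q =>
    (memLp_mul_eval _ p q).integrable (by norm_num)
  have hn' : (n : ℝ) ≠ 0 := by exact_mod_cast hn
  refine measure_ge_le_ofReal_div (fun w => Finset.sum_nonneg fun k _ =>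
    integral_nonneg fun u => sq_nonneg _) ?_ hB ?_
  · simp only [integral_readout_sq]
    exact integrable_finsetSum _ fun k _ => integrable_finsetSum _ fun i _ =>
      integrable_finsetSum _ fun j _ => (hmul _ _).mul_const _
  · simp only [integral_readout_sq]
    rw [integral_finsetSum _ fun k _ => integrable_finsetSum _ fun i _ =>
      integrable_finsetSum _ fun j _ => (hmul _ _).mul_const _]
    have hk : ∀ k : Fin c,
        ∫ w, ∑ i, ∑ j, w (k, i) * w (k, j) * reluMoment (n := n) i j ∂μ ≤ 1 := fun k => by
      rw [integral_finsetSum _ fun i _ => integrable_finsetSum _ fun j _ => (hmul _ _).mul_const _]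
      calc _ = ∑ i : Fin n, (n : ℝ)⁻¹ * reluMoment i i := by
            refine Finset.sum_congr rfl fun i _ => ?_
            rw [integral_finsetSum _ fun j _ => (hmul _ _).mul_const _]
            simp only [integral_mul_const, hμ, integral_mul_eval, Prod.mk.injEq, true_and]
            simp
        _ ≤ ∑ _i : Fin n, (n : ℝ)⁻¹ := Finset.sum_le_sum fun i _ =>
            mul_le_of_le_one_right (by positivity) (reluMoment_self_le i)
        _ = 1 := by simp [hn']
    exact (Finset.sum_le_sum fun k _ => hk k).trans_eq (by simp)

theorem tendsto_measure_sum_pow_four_ge (c : ℕ) {τ : ℝ} (hτ : 0 < τ) :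
    Tendsto (fun n : ℕ => (Measure.pi fun _ : Fin c × Fin n => gaussianReal 0 (n : ℝ≥0)⁻¹)
      {w | τ ≤ ∑ p, w p ^ 4}) atTop (nhds 0) := by
  set C := ∫ x, x ^ 4 ∂gaussianReal 0 1
  have hb : Tendsto (fun n : ℕ => ENNReal.ofReal ((n : ℝ)⁻¹ * (c * C / τ))) atTop (nhds 0) := by
    rw [← ENNReal.ofReal_zero]
    refine ENNReal.tendsto_ofReal ?_
    simpa using (tendsto_inv_atTop_nhds_zero_nat (𝕜 := ℝ)).mul_const (c * C / τ)
  refine tendsto_of_tendsto_of_tendsto_of_le_of_le' tendsto_const_nhds hb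
    (.of_forall fun _ => zero_le) ?_
  filter_upwards [eventually_ne_atTop 0] with n hn
  have hn' : (n : ℝ) ≠ 0 := by exact_mod_cast hn
  have hi := fun p : Fin c × Fin n =>
    integrable_comp_eval (n : ℝ≥0)⁻¹ p (integrable_pow_four_gaussianReal _)
  rw [← mul_div_assoc]
  refine measure_ge_le_ofReal_div (fun w => Finset.sum_nonneg fun p _ => by positivity)
    (integrable_finsetSum _ fun p _ => hi p) hτ ?_
  rw [integral_finsetSum _ fun p _ => hi p]
  have he := fun p : Fin c × Fin n =>
    integral_comp_eval (n : ℝ≥0)⁻¹ p (f := fun x => x ^ 4) (by fun_prop)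
  simp only [he, integral_pow_four_gaussianReal (n : ℝ≥0)⁻¹, Finset.sum_const, Finset.card_univ,
    Fintype.card_prod, Fintype.card_fin, nsmul_eq_mul]
  push_cast
  refine le_of_eq ?_
  field_simp
  rfl

/-- The probability that the eigenvalue ratio of the mean Hessian is not small vanishes. -/
theorem tendsto_measure_ratio_ge (hc : 2 ≤ c) {ε : ℝ} (hε : 0 < ε) :
    Tendsto (fun n : ℕ => (Measure.pi fun _ : Fin c × Fin n => gaussianReal 0 (n : ℝ≥0)⁻¹)
      {w | ∃ a b : Fin n, (a : ℕ) = c - 1 ∧ (b : ℕ) = c - 2 ∧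
        ε ≤ sortedEig (meanHess (inputMeasure n) w) a
          / sortedEig (meanHess (inputMeasure n) w) b}) atTop (nhds 0) := by
  have hc' : (2 : ℝ) ≤ c := by exact_mod_cast hc
  rw [ENNReal.tendsto_nhds_zero]
  intro δ hδ
  have hlim : Tendsto (fun B : ℝ => ENNReal.ofReal (c / B)) atTop (nhds 0) := by
    rw [← ENNReal.ofReal_zero]
    exact ENNReal.tendsto_ofReal (tendsto_const_nhds.div_atTop tendsto_id)
  obtain ⟨B, hBδ, hB⟩ := ((ENNReal.tendsto_nhds_zero.1 hlim (δ / 2) (ENNReal.half_pos hδ.ne')).and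
    (eventually_gt_atTop 0)).exists
  set κ := Real.exp (-(2 * √(2 * B))) / (16 * c) with hκ
  have hκ0 : 0 < κ := by positivity
  set ρ := ε * κ / (2 * (1 + ε)) with hρ
  have hρ0 : 0 < ρ := by positivity
  have hρε : ρ < ε * (κ - ρ) := by
    have h1 : ρ * (1 + ε) = ε * κ / 2 := by rw [hρ]; field_simp
    have h2 : 0 < ε * κ := by positivity
    linarith
  set K : ℝ := (288 * c ^ 2 + 4) * c ^ 3 with hK
  have hK0 : 0 < K := by positivity
  have hτ : 0 < ρ ^ 2 / K := by positivity
  have hG : (0 : ℝ) < 1 / (2 * c) := by positivity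
  have hlim2 := (tendsto_measure_gram c hG).add (tendsto_measure_sum_pow_four_ge c hτ)
  rw [add_zero] at hlim2
  filter_upwards [ENNReal.tendsto_nhds_zero.1 hlim2 (δ / 2) (ENNReal.half_pos hδ.ne'),
    eventually_ne_atTop 0] with n hn hn0
  set μ := Measure.pi fun _ : Fin c × Fin n => gaussianReal 0 (n : ℝ≥0)⁻¹
  calc _ ≤ μ ({w | ∃ k l, 1 / (2 * c) ≤ |rowGram w k l - (1 : Matrix (Fin c) (Fin c) ℝ) k l|}
        ∪ {w | ρ ^ 2 / K ≤ ∑ p, w p ^ 4}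
        ∪ {w | B ≤ ∑ k, ∫ u, readout w u k ^ 2 ∂inputMeasure n}) := measure_mono ?_
    _ ≤ _ := (measure_union_le _ _).trans (add_le_add (measure_union_le _ _) le_rfl)
    _ ≤ δ / 2 + δ / 2 := add_le_add hn ((measure_readout_sq_ge_le hn0 hB).trans hBδ)
    _ = δ := ENNReal.add_halves δ
  rintro w ⟨a, b, ha, hb, hab⟩
  by_contra hw
  simp only [Set.mem_union, Set.mem_ofPred_eq, not_or, not_exists, not_le] at hw
  obtain ⟨⟨hw1, hw2⟩, hw3⟩ := hw
  refine hab.not_gt (ratio_lt_of_bounds hc w hε hρ0.le ?_ (fun k l => (hw1 k l).le) hB hw3.le hρε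
    ha hb)
  have hdiag : ∑ k, rowGram w k k ≤ 2 * c := by
    calc _ ≤ ∑ _k : Fin c, (2 : ℝ) := Finset.sum_le_sum fun k _ => by
          have h1 := (abs_lt.1 (hw1 k k)).2
          have h2 : 1 / (2 * c) ≤ (1 : ℝ) := by
            rw [div_le_one (by positivity)]; linarith
          rw [Matrix.one_apply_eq] at h1
          linarith
      _ = _ := by simp [mul_comm]
  calc _ ≤ (144 * (c * ∑ k, rowGram w k k) + 4) * (c ^ 3 * ∑ p, w p ^ 4) := sum_hessResidual_sq_le w
    _ ≤ (144 * (c * (2 * c)) + 4) * (c ^ 3 * (ρ ^ 2 / K)) := by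
        gcongr
    _ = ρ ^ 2 := by rw [hK]; field_simp; ring

end OuterLimit

theorem isHermitian_outputHessian {c d n : ℕ}
    (w : ((Fin n × Fin d) → ℝ) × ((Fin c × Fin n) → ℝ)) : (outputHessian c d n w).IsHermitian := by
  rw [outputHessian_eq_meanHess]
  exact isHermitian_meanHess _ _

/-- **At random initialization the output Hessian is approximately of rank `c − 1`.**
For every `ε > 0`, `lim_{n→∞} lim_{d→∞} P[ λ_c(M) / λ_{c−1}(M) < ε ] = 1` (iterated
limit, stated via the inner limits `L n`).  The `k`-th largest eigenvalue is encoded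
via an antitone enumeration `lam` of the roots of the characteristic polynomial of
`M`, so that `λ_c(M) = lam (c-1)` and `λ_{c−1}(M) = lam (c-2)` (0-based). -/
theorem outputHessian_approx_rank_c_sub_one
    (c : ℕ) (hc : 2 ≤ c) (ε : ℝ) (hε : 0 < ε) :
    ∃ L : ℕ → ℝ≥0∞,
      (∀ n : ℕ,
        Tendsto (fun d : ℕ =>
            weightMeasure c d n
              {w | ∀ lam : Fin n → ℝ, Antitone lam →
                (outputHessian c d n w).charpoly
                    = ∏ k : Fin n, (Polynomial.X - Polynomial.C (lam k)) →
                ∀ (h1 : c - 1 < n) (h2 : c - 2 < n),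
                  lam ⟨c - 1, h1⟩ / lam ⟨c - 2, h2⟩ < ε})
          atTop (nhds (L n))) ∧
      Tendsto L atTop (nhds 1) := by
  have heq : ∀ n d, {w : (Fin n × Fin d → ℝ) × (Fin c × Fin n → ℝ) |
      ∀ lam : Fin n → ℝ, Antitone lam →
        (outputHessian c d n w).charpoly
            = ∏ k : Fin n, (Polynomial.X - Polynomial.C (lam k)) →
        ∀ (h1 : c - 1 < n) (h2 : c - 2 < n), lam ⟨c - 1, h1⟩ / lam ⟨c - 2, h2⟩ < ε}
      = {w | ∀ (h1 : c - 1 < n) (h2 : c - 2 < n), sortedEig (outputHessian c d n w) ⟨c - 1, h1⟩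
          / sortedEig (outputHessian c d n w) ⟨c - 2, h2⟩ < ε} := fun n d => by
    ext w
    have hs := isSpectrum_sortedEig (isHermitian_outputHessian w)
    refine ⟨fun h => h _ hs.1 hs.2, fun h lam h1 h2 => ?_⟩
    obtain rfl := hs.unique ⟨h1, h2⟩
    exact h
  simp only [heq]
  refine ⟨fun n => (Measure.pi fun _ : Fin c × Fin n => gaussianReal 0 (n : ℝ≥0)⁻¹)
    {w | ∀ (h1 : c - 1 < n) (h2 : c - 2 < n), sortedEig (meanHess (inputMeasure n) w) ⟨c - 1, h1⟩
      / sortedEig (meanHess (inputMeasure n) w) ⟨c - 2, h2⟩ < ε}, fun n => ?_, ?_⟩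
  · by_cases hn : c - 1 < n
    · have hn2 : c - 2 < n := by omega
      simp only [hn, hn2, forall_true_left]
      refine tendsto_weightMeasure_ratio_lt hc hε (Fin.mk_lt_mk.2 ?_)
      omega
    · have : ∀ d, IsProbabilityMeasure (weightMeasure c d n) := fun d => by
        unfold weightMeasure; infer_instance
      simp only [hn, IsEmpty.forall_iff, Set.ofPred_true, measure_univ, tendsto_const_nhds]
  · have h := tendsto_measure_of_iff
      (fun n : ℕ => Measure.pi fun _ : Fin c × Fin n => gaussianReal 0 (n : ℝ≥0)⁻¹)
      (A := fun n => {w : Fin c × Fin n → ℝ | ∀ (h1 : c - 1 < n) (h2 : c - 2 < n),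
        sortedEig (meanHess (inputMeasure n) w) ⟨c - 1, h1⟩
          / sortedEig (meanHess (inputMeasure n) w) ⟨c - 2, h2⟩ < ε})
      (tendsto_measure_ratio_ge hc hε) True fun n w hw =>
        iff_of_true (fun h1 h2 => not_le.1 fun hle => hw ⟨_, _, rfl, rfl, hle⟩) trivial
    simpa using h
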